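/- arXiv:1909.11636 — 14 statements merged into one kernel-verified Lean document; each statement's English description precedes it below -/
import Mathlib

section
/- Let R be a commutative Noetherian ring and let S be a commutative R-algebra with ideals I, J ⊆ S such that both quotient algebras S/I and S/J are finitely generated as R-algebras. Then S/(I ∩ J) is a finitely generated R-algebra. -/
theorem aux_lift (R : Type*) [CommRing R]
    (S : Type*) [CommRing S] [Algebra R S] (I : Ideal S)
    (hI : Algebra.FiniteType R (S ⧸ I)) :
    ∃ s : Set S, s.Finite ∧ ∀ y : S ⧸ I, ∃ a ∈ Algebra.adjoin R s, Ideal.Quotient.mk I a = y := by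
  obtain ⟨t, ht⟩ := hI.out
  have hs : Function.Surjective (Ideal.Quotient.mkₐ R I) := Ideal.Quotient.mkₐ_surjective R I
  refine ⟨Function.surjInv hs '' (t : Set (S ⧸ I)), t.finite_toSet.image _, fun y => ?_⟩
  have h : (Algebra.adjoin R (Function.surjInv hs '' (t : Set (S ⧸ I)))).map
      (Ideal.Quotient.mkₐ R I) = ⊤ := by
    rw [AlgHom.map_adjoin, ← Set.image_comp, ← ht]
    congr 1
    convert Set.image_id _
    exact funext fun x => Function.surjInv_eq hs x
  have hy : y ∈ (Algebra.adjoin R (Function.surjInv hs '' (t : Set (S ⧸ I)))).map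
      (Ideal.Quotient.mkₐ R I) := h ▸ Algebra.mem_top
  obtain ⟨a, ha, rfl⟩ := hy
  exact ⟨a, ha, rfl⟩

theorem aux_fin (R : Type*) [CommRing R]
    (S : Type*) [CommRing S] [Algebra R S] (I : Ideal S) (A : Subalgebra R S)
    (h : ∀ y : S ⧸ I, ∃ a ∈ A, Ideal.Quotient.mk I a = y) : Module.Finite A (S ⧸ I) := by
  refine Module.Finite.of_surjective (Algebra.linearMap A (S ⧸ I)) fun y => ?_
  obtain ⟨a, ha, rfl⟩ := h y
  exact ⟨⟨a, ha⟩, rfl⟩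

/-- Over a commutative Noetherian ring `R`, if `S/I` and `S/J` are finitely
generated `R`-algebras, then so is `S/(I ∩ J)`. -/
theorem pushouts_stmt2 (R : Type*) [CommRing R] [IsNoetherianRing R]
    (S : Type*) [CommRing S] [Algebra R S] (I J : Ideal S)
    (hI : Algebra.FiniteType R (S ⧸ I)) (hJ : Algebra.FiniteType R (S ⧸ J)) :
    Algebra.FiniteType R (S ⧸ (I ⊓ J)) := by
  obtain ⟨s, hs, hs'⟩ := aux_lift R S I hI
  obtain ⟨t, ht, ht'⟩ := aux_lift R S J hJ
  let A := Algebra.adjoin R (s ∪ t)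
  have hA : Algebra.FiniteType R A :=
    A.fg_iff_finiteType.1 (Subalgebra.fg_def.2 ⟨s ∪ t, hs.union ht, rfl⟩)
  have hN : IsNoetherianRing A := Algebra.FiniteType.isNoetherianRing R A
  have h1 : Module.Finite A (S ⧸ I) := aux_fin R S I A fun y => by
    obtain ⟨a, ha, h⟩ := hs' y
    exact ⟨a, Algebra.adjoin_mono Set.subset_union_left ha, h⟩
  have h2 : Module.Finite A (S ⧸ J) := aux_fin R S J A fun y => by
    obtain ⟨a, ha, h⟩ := ht' y
    exact ⟨a, Algebra.adjoin_mono Set.subset_union_right ha, h⟩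
  let f : (S ⧸ (I ⊓ J)) →ₐ[A] (S ⧸ I) × (S ⧸ J) :=
    (Ideal.Quotient.factorₐ A inf_le_left).prod (Ideal.Quotient.factorₐ A inf_le_right)
  have hf : Function.Injective f := by
    rw [injective_iff_map_eq_zero]
    intro x hx
    obtain ⟨x, rfl⟩ := Ideal.Quotient.mk_surjective x
    have a1 : Ideal.Quotient.mk I x = 0 := congrArg Prod.fst hx
    have a2 : Ideal.Quotient.mk J x = 0 := congrArg Prod.snd hx
    rw [Ideal.Quotient.eq_zero_iff_mem] at a1 a2 ⊢
    exact ⟨a1, a2⟩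
  have h3 : Module.Finite A (S ⧸ (I ⊓ J)) := Module.Finite.of_injective f.toLinearMap hf
  exact Algebra.FiniteType.trans (S := A) hA inferInstance
end

section
/- Let A, B, C be commutative Noetherian rings and let φ: B → A and ψ: C → A be ring homomorphisms. Let P = {(b,c) ∈ B × C : φ(b) = ψ(c)} be the pullback, a subring of B × C. Then P is a Noetherian ring if and only if both subrings φ⁻¹(Im φ ∩ Im ψ) of B and ψ⁻¹(Im φ ∩ Im ψ) of C are Noetherian rings. -/
theorem noeth_of_joint {P B C : Type*} [CommRing P] [CommRing B] [CommRing C]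
    [IsNoetherianRing B] [IsNoetherianRing C] (f : P →+* B) (g : P →+* C)
    (hf : Function.Surjective f) (hg : Function.Surjective g)
    (h : ∀ x, f x = 0 → g x = 0 → x = 0) : IsNoetherianRing P := by
  let : Module P B := Module.compHom B f
  let : Module P C := Module.compHom C g
  have : RingHomSurjective f := ⟨hf⟩
  have : RingHomSurjective g := ⟨hg⟩
  have hB : IsNoetherian P B :=
    (LinearMap.isNoetherian_iff_of_bijective
      ({ toFun := fun x => x, map_add' := fun _ _ => rfl, map_smul' := fun _ _ => rfl } : B →ₛₗ[f] B)
      Function.bijective_id).2 inferInstance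
  have hC : IsNoetherian P C :=
    (LinearMap.isNoetherian_iff_of_bijective
      ({ toFun := fun x => x, map_add' := fun _ _ => rfl, map_smul' := fun _ _ => rfl } : C →ₛₗ[g] C)
      Function.bijective_id).2 inferInstance
  let F : P →ₗ[P] B × C :=
    { toFun := fun x => (f x, g x)
      map_add' := fun x y => by simp
      map_smul' := fun r x => by
        ext
        · exact map_mul f r x
        · exact map_mul g r x }
  refine isNoetherian_of_injective F ((injective_iff_map_eq_zero F).2 fun x hx => ?_)
  exact h x (congrArg Prod.fst hx) (congrArg Prod.snd hx)


/-- For Noetherian commutative rings `A, B, C` and homomorphisms `φ : B → A`,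
`ψ : C → A`, the pullback `P = {(b,c) : φ b = ψ c} ⊆ B × C` is Noetherian iff both
`φ⁻¹(Im φ ∩ Im ψ)` and `ψ⁻¹(Im φ ∩ Im ψ)` are Noetherian. -/
theorem pushouts_stmt3 (A B C : Type*) [CommRing A] [CommRing B] [CommRing C]
    [IsNoetherianRing A] [IsNoetherianRing B] [IsNoetherianRing C]
    (φ : B →+* A) (ψ : C →+* A) :
    IsNoetherianRing
        (RingHom.eqLocus (φ.comp (RingHom.fst B C)) (ψ.comp (RingHom.snd B C))) ↔
      (IsNoetherianRing ((φ.range ⊓ ψ.range).comap φ) ∧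
        IsNoetherianRing ((φ.range ⊓ ψ.range).comap ψ)) := by
  let P := RingHom.eqLocus (φ.comp (RingHom.fst B C)) (ψ.comp (RingHom.snd B C))
  let f : P →+* (φ.range ⊓ ψ.range).comap φ :=
    ((RingHom.fst B C).comp P.subtype).codRestrict _ fun x =>
      ⟨⟨x.1.1, rfl⟩, ⟨x.1.2, x.2.symm⟩⟩
  let g : P →+* (φ.range ⊓ ψ.range).comap ψ :=
    ((RingHom.snd B C).comp P.subtype).codRestrict _ fun x =>
      ⟨⟨x.1.1, x.2⟩, ⟨x.1.2, rfl⟩⟩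
  have hf : Function.Surjective f := by
    rintro ⟨b, _, ⟨c, hc⟩⟩
    exact ⟨⟨(b, c), hc.symm⟩, rfl⟩
  have hg : Function.Surjective g := by
    rintro ⟨c, ⟨b, hb⟩, _⟩
    exact ⟨⟨(b, c), hb⟩, rfl⟩
  constructor
  · intro hP
    exact ⟨isNoetherianRing_of_surjective P _ f hf, isNoetherianRing_of_surjective P _ g hg⟩
  · rintro ⟨h1, h2⟩
    refine noeth_of_joint f g hf hg fun x hx hy => ?_
    exact Subtype.ext (Prod.ext (congrArg Subtype.val hx) (congrArg Subtype.val hy))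
end

section
/- Let R be a commutative Noetherian ring, let A, B, C be finitely generated commutative R-algebras, and let φ: B → A and ψ: C → A be R-algebra homomorphisms. Let P = {(b,c) ∈ B × C : φ(b) = ψ(c)} be the pullback, an R-subalgebra of B × C. Then P is a finitely generated R-algebra if and only if both R-subalgebras φ⁻¹(Im φ ∩ Im ψ) of B and ψ⁻¹(Im φ ∩ Im ψ) of C are finitely generated R-algebras. -/
theorem exists_lift {R S T : Type*} [CommRing R] [CommRing S] [CommRing T]
    [Algebra R S] [Algebra R T] (P : Subalgebra R S) (f : S →ₐ[R] T) (h : (P.map f).FG) :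
    ∃ t : Finset S, (t : Set S) ⊆ P ∧ (Algebra.adjoin R (t : Set S)).map f = P.map f := by
  classical
  obtain ⟨s, hs⟩ := h
  have h1 : (s : Set T) ⊆ f '' (P : Set S) := by
    intro x hx
    have : x ∈ P.map f := by rw [← hs]; exact Algebra.subset_adjoin hx
    exact this
  obtain ⟨t, ht, hts⟩ := Finset.subset_set_image_iff.1 h1
  refine ⟨t, ht, ?_⟩
  rw [AlgHom.map_adjoin, ← hs, ← hts, Finset.coe_image]

/-- For finitely generated algebras `A, B, C` over a commutative Noetherian ring
`R` and `R`-algebra homomorphisms `φ : B → A`, `ψ : C → A`, the pullback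
`P = {(b,c) : φ b = ψ c} ⊆ B × C` is a finitely generated `R`-algebra iff both
`φ⁻¹(Im φ ∩ Im ψ)` and `ψ⁻¹(Im φ ∩ Im ψ)` are finitely generated `R`-algebras. -/
theorem pushouts_stmt4 (R : Type*) [CommRing R] [IsNoetherianRing R]
    (A B C : Type*) [CommRing A] [CommRing B] [CommRing C]
    [Algebra R A] [Algebra R B] [Algebra R C]
    [Algebra.FiniteType R A] [Algebra.FiniteType R B] [Algebra.FiniteType R C]
    (φ : B →ₐ[R] A) (ψ : C →ₐ[R] A) :
    (AlgHom.equalizer (φ.comp (AlgHom.fst R B C)) (ψ.comp (AlgHom.snd R B C))).FG ↔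
      (((φ.range ⊓ ψ.range).comap φ).FG ∧ ((φ.range ⊓ ψ.range).comap ψ).FG) := by
  set P := AlgHom.equalizer (φ.comp (AlgHom.fst R B C)) (ψ.comp (AlgHom.snd R B C)) with hP
  have memP : ∀ b c, (b, c) ∈ P ↔ φ b = ψ c := by
    intro b c
    rw [hP, AlgHom.mem_equalizer]
    rfl
  have hB : (φ.range ⊓ ψ.range).comap φ = P.map (AlgHom.fst R B C) := by
    ext b
    constructor
    · rintro ⟨-, c, hc⟩
      exact ⟨(b, c), (memP b c).2 hc.symm, rfl⟩
    · rintro ⟨⟨b', c⟩, h, rfl⟩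
      exact ⟨⟨b', rfl⟩, c, ((memP b' c).1 h).symm⟩
  have hC : (φ.range ⊓ ψ.range).comap ψ = P.map (AlgHom.snd R B C) := by
    ext c
    constructor
    · rintro ⟨⟨b, hb⟩, -⟩
      exact ⟨(b, c), (memP b c).2 hb, rfl⟩
    · rintro ⟨⟨b, c'⟩, h, rfl⟩
      exact ⟨⟨b, (memP b c').1 h⟩, c', rfl⟩
  rw [hB, hC]
  constructor
  · intro h
    exact ⟨h.map _, h.map _⟩
  · rintro ⟨h1, h2⟩
    have : Algebra.FiniteType R (P.map (AlgHom.snd R B C)) :=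
      (Subalgebra.fg_iff_finiteType _).1 h2
    have hN : IsNoetherianRing (P.map (AlgHom.snd R B C)) :=
      Algebra.FiniteType.isNoetherianRing R _
    obtain ⟨t1, ht1, hm1⟩ := exists_lift P (AlgHom.fst R B C) h1
    obtain ⟨t2, ht2, hm2⟩ := exists_lift P (AlgHom.snd R B C) h2
    obtain ⟨k, hk⟩ := (isNoetherianRing_iff_ideal_fg _).1 hN
      (RingHom.ker (ψ.comp (P.map (AlgHom.snd R B C)).val))
    classical
    let t3 : Finset (B × C) := k.image (fun x : P.map (AlgHom.snd R B C) => ((0 : B), (x : C)))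
    refine ⟨t1 ∪ t2 ∪ t3, ?_⟩
    set Q := Algebra.adjoin R ((t1 ∪ t2 ∪ t3 : Finset (B × C)) : Set (B × C)) with hQ
    have s1 : (t1 : Set (B × C)) ⊆ Q := fun x hx =>
      Algebra.subset_adjoin (by simp at hx ⊢; tauto)
    have s2 : (t2 : Set (B × C)) ⊆ Q := fun x hx =>
      Algebra.subset_adjoin (by simp at hx ⊢; tauto)
    have s3 : (t3 : Set (B × C)) ⊆ Q := fun x hx =>
      Algebra.subset_adjoin (by simp at hx ⊢; tauto)
    have hK : ∀ x ∈ RingHom.ker (ψ.comp (P.map (AlgHom.snd R B C)).val),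
        ((0 : B), (x : C)) ∈ Q := by
      intro x hx
      rw [← hk] at hx
      induction hx using Submodule.span_induction with
      | mem x hx => exact s3 (Finset.mem_coe.2 (Finset.mem_image_of_mem _ hx))
      | zero => exact Q.zero_mem
      | add x y _ _ h h' => simpa using Q.add_mem h h'
      | smul a x _ h =>
        have ha : (a : C) ∈ (Algebra.adjoin R (t2 : Set (B × C))).map (AlgHom.snd R B C) := by
          rw [hm2]; exact a.2
        obtain ⟨q, hq, hqa⟩ := ha
        have hqQ : q ∈ Q := Algebra.adjoin_le s2 hq
        have := Q.mul_mem hqQ h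
        have e : q * ((0 : B), (x : C)) = ((0 : B), ((a • x : P.map (AlgHom.snd R B C)) : C)) := by
          ext
          · simp
          · have : q.2 = (a : C) := hqa
            simp [this]
        rwa [e] at this
    apply le_antisymm
    · apply Algebra.adjoin_le
      intro x hx
      simp only [Finset.coe_union, Set.mem_union, Finset.mem_coe] at hx
      rcases hx with (hx | hx) | hx
      · exact ht1 hx
      · exact ht2 hx
      · obtain ⟨y, hy, rfl⟩ := Finset.mem_image.1 hx
        have hy' : y ∈ RingHom.ker (ψ.comp (P.map (AlgHom.snd R B C)).val) := by
          rw [← hk]; exact Submodule.subset_span hy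
        have h0 : ψ (y : C) = 0 := hy'
        exact (memP _ _).2 (by rw [h0, map_zero])
    · intro p hp
      have hp1 : p.1 ∈ (Algebra.adjoin R (t1 : Set (B × C))).map (AlgHom.fst R B C) := by
        rw [hm1]; exact ⟨p, hp, rfl⟩
      obtain ⟨q, hq, hqp⟩ := hp1
      have hqp : q.1 = p.1 := hqp
      have hqP : q ∈ P := Algebra.adjoin_le ht1 hq
      have hqQ : q ∈ Q := Algebra.adjoin_le s1 hq
      have hd : p - q ∈ P := P.sub_mem hp hqP
      have e : p - q = ((0 : B), (p - q).2) := by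
        ext
        · simp [hqp]
        · rfl
      have hd' := hd
      rw [e, memP, map_zero] at hd'
      have := hK ⟨(p - q).2, p - q, hd, rfl⟩ hd'.symm
      have h3 : p - q ∈ Q := by rw [e]; exact this
      simpa using Q.add_mem h3 hqQ
end

section
/- Let B be a commutative Noetherian ring, let S ⊆ B be a subring, and suppose there exists an ideal I of B with I ⊆ S. If S is Noetherian, then for every non-zero f ∈ I, the quotient B/Ann_B(f) is a finitely generated S-module, where Ann_B(f) = {b ∈ B : bf = 0} is the annihilator of f in B and the S-module structure on B/Ann_B(f) is obtained by restricting scalars along the inclusion S ⊆ B. -/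
/-- Let `B` be Noetherian, `S ⊆ B` a subring containing an ideal `I` of `B`.
If `S` is Noetherian, then for every non-zero `f ∈ I` the quotient `B / Ann_B(f)` is a
finitely generated `S`-module (scalars restricted along `S ⊆ B`). -/
theorem pushouts_stmt5 (B : Type*) [CommRing B] [IsNoetherianRing B]
    (S : Subring B) (I : Ideal B) (hIS : (I : Set B) ⊆ S)
    (hS : IsNoetherianRing S) (f : B) (hfI : f ∈ I) (hf : f ≠ 0) :
    Module.Finite S (B ⧸ (Ideal.span {f} : Ideal B).annihilator) := by
  let A : Ideal B := (Ideal.span {f} : Ideal B).annihilator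
  have hA : ∀ b : B, b ∈ A ↔ b * f = 0 := fun b => by
    simp [A, Submodule.mem_annihilator_span_singleton]
  let h : (B ⧸ A) →ₗ[B] B := Submodule.liftQ A (LinearMap.toSpanSingleton B B f) (by
    intro b hb
    simpa using (hA b).1 hb)
  have hh : ∀ b : B, h (Submodule.Quotient.mk b) = b * f := fun b => by
    rfl
  have hmem : ∀ x, h x ∈ S := by
    intro x
    obtain ⟨b, rfl⟩ := Submodule.Quotient.mk_surjective A x
    rw [hh]
    exact hIS (I.mul_mem_left b hfI)
  let g : (B ⧸ A) →ₗ[S] S :=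
    { toFun := fun x => ⟨h x, hmem x⟩
      map_add' := fun x y => Subtype.ext (h.map_add x y)
      map_smul' := fun s x => Subtype.ext (h.map_smul (s : B) x) }
  have hg : Function.Injective g := by
    rw [injective_iff_map_eq_zero]
    intro x hx
    obtain ⟨b, rfl⟩ := Submodule.Quotient.mk_surjective A x
    have h0 : h (Submodule.Quotient.mk b) = 0 := congrArg Subtype.val hx
    rw [hh] at h0
    exact (Submodule.Quotient.mk_eq_zero A).2 ((hA b).2 h0)
  exact Module.Finite.of_injective g hg
end

section
/- Let B be a commutative Noetherian ring that is coprimary as a module over itself (i.e., B has exactly one associated prime as a B-module), let S ⊆ B be a subring, and suppose there exists a non-zero ideal I of B with I ⊆ S. Then S is a Noetherian ring if and only if B is a finitely generated S-module. -/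
theorem eakin_aux (A B : Type*) [CommRing A] [CommRing B] [Algebra A B] [IsNoetherianRing B]
    [Module.Finite A B] (K : Ideal B) : IsNoetherian A (B ⧸ K) := by
  induction K using IsNoetherian.induction with
  | hgt K ih =>
  set T : Set (Submodule A B) := {N | K.restrictScalars A ≤ N ∧
    ∀ s : A, (∀ b : B, s • b ∈ N) → algebraMap A B s ∈ K} with hT
  obtain ⟨N, -, hN⟩ : ∃ N, K.restrictScalars A ≤ N ∧ Maximal (· ∈ T) N := by
    apply zorn_le_nonempty₀ T
    · intro c hcT hc y hy
      refine ⟨sSup c, ⟨(hcT hy).1.trans (le_sSup hy), ?_⟩, fun z hz => le_sSup hz⟩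
      intro s hs
      have hfg : (LinearMap.range (LinearMap.lsmul A B s)).FG := by
        rw [LinearMap.range_eq_map]
        exact Module.Finite.fg_top.map _
      rw [Submodule.fg_iff_compact] at hfg
      obtain ⟨z, hz, hz2⟩ := (CompleteLattice.isCompactElement_iff_le_of_directed_sSup_le _ _).1
        hfg c ⟨y, hy⟩ hc.directedOn (by rintro _ ⟨b, rfl⟩; exact hs b)
      exact (hcT hz).2 s fun b => hz2 ⟨b, rfl⟩
    · refine ⟨le_rfl, fun s hs => ?_⟩
      simpa [Algebra.smul_def] using hs 1
  have hNT : N ∈ T := hN.prop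
  have hNoeth : IsNoetherian A (B ⧸ N) := by
    refine ⟨fun P => ?_⟩
    by_cases hP : P = ⊥
    · rw [hP]; exact Submodule.fg_bot
    have hlt : N < P.comap N.mkQ := by
      refine lt_of_le_of_ne ?_ ?_
      · intro x hx
        have : N.mkQ x = 0 := by simpa using hx
        simp [Submodule.mem_comap, this]
      · intro h
        apply hP
        rw [eq_bot_iff]
        intro x hx
        obtain ⟨b, rfl⟩ := N.mkQ_surjective x
        have : b ∈ N := by rw [h]; exact hx
        simpa using this
    have hnot : P.comap N.mkQ ∉ T := fun h => hlt.not_ge (hN.le_of_ge h hlt.le)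
    have : ∃ s : A, (∀ b : B, s • b ∈ P.comap N.mkQ) ∧ algebraMap A B s ∉ K := by
      by_contra hcon
      push Not at hcon
      exact hnot ⟨hNT.1.trans hlt.le, hcon⟩
    obtain ⟨s, hs, hsK⟩ := this
    set J : Ideal B := K ⊔ Ideal.span {algebraMap A B s} with hJ
    have hJK : K < J := by
      refine lt_of_le_of_ne le_sup_left fun h => hsK ?_
      rw [h]
      exact (le_sup_right : _ ≤ J) (Ideal.subset_span rfl)
    have hJn := ih J hJK
    set R := LinearMap.range (LinearMap.lsmul A (B ⧸ N) s) with hR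
    have hle : J.restrictScalars A ≤ LinearMap.ker (R.mkQ ∘ₗ N.mkQ) := by
      intro x hx
      obtain ⟨k, hk, y, hy, rfl⟩ := Submodule.mem_sup.1 (show x ∈ J from hx)
      obtain ⟨z, rfl⟩ := Ideal.mem_span_singleton'.1 hy
      have h1 : N.mkQ k = 0 := by
        have := hNT.1 (show k ∈ K.restrictScalars A from hk)
        simpa using this
      have h2 : N.mkQ (z * algebraMap A B s) ∈ R := by
        refine ⟨N.mkQ z, ?_⟩
        rw [LinearMap.lsmul_apply, ← map_smul, Algebra.smul_def, mul_comm]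
      rw [LinearMap.mem_ker, LinearMap.comp_apply, map_add, h1, zero_add]
      exact (Submodule.Quotient.mk_eq_zero R).2 h2
    have hQ : IsNoetherian A ((B ⧸ N) ⧸ R) := by
      have e : IsNoetherian A (B ⧸ J.restrictScalars A) := hJn
      refine isNoetherian_of_surjective ((J.restrictScalars A).liftQ _ hle) ?_
      rw [Submodule.range_liftQ, LinearMap.range_eq_top]
      exact R.mkQ_surjective.comp N.mkQ_surjective
    refine Submodule.fg_of_fg_map_of_fg_inf_ker R.mkQ (IsNoetherian.noetherian _) ?_
    rw [Submodule.ker_mkQ, inf_eq_right.2]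
    · rw [hR, LinearMap.range_eq_map]
      exact Module.Finite.fg_top.map _
    · rintro _ ⟨x, rfl⟩
      obtain ⟨b, rfl⟩ := N.mkQ_surjective x
      exact hs b
  -- now A / (K ∩ A) is Noetherian
  obtain ⟨n, g, hg⟩ := Module.Finite.exists_fin (R := A) (M := B)
  let φ : A →ₗ[A] (Fin n → B ⧸ N) := LinearMap.pi fun i =>
    N.mkQ ∘ₗ LinearMap.toSpanSingleton A B (g i)
  have hφ : IsNoetherian A (A ⧸ LinearMap.ker φ) :=
    isNoetherian_of_injective ((LinearMap.ker φ).liftQ φ le_rfl)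
      (LinearMap.ker_eq_bot.1 (Submodule.ker_liftQ_eq_bot _ _ _ le_rfl))
  have hker : ∀ s ∈ LinearMap.ker φ, algebraMap A B s ∈ K := by
    intro s hs
    refine hNT.2 s fun b => ?_
    have hb : b ∈ Submodule.span A (Set.range g) := by rw [hg]; trivial
    have : Submodule.span A (Set.range g) ≤ N.comap (LinearMap.lsmul A B s) := by
      rw [Submodule.span_le]
      rintro _ ⟨i, rfl⟩
      have := congrFun (LinearMap.mem_ker.1 hs) i
      simpa [φ] using (Submodule.Quotient.mk_eq_zero N).1 this
    exact this hb
  let ψ : ∀ i : Fin n, (A ⧸ LinearMap.ker φ) →ₗ[A] B ⧸ K := fun i =>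
    (LinearMap.ker φ).liftQ ((Ideal.Quotient.mkₐ A K).toLinearMap ∘ₗ
      LinearMap.toSpanSingleton A B (g i)) (by
        intro s hs
        have := Ideal.mul_mem_right (g i) K (hker s hs)
        rw [← Algebra.smul_def] at this
        exact Ideal.Quotient.eq_zero_iff_mem.2 this)
  refine isNoetherian_of_surjective (LinearMap.lsum A (fun _ => A ⧸ LinearMap.ker φ) A ψ) ?_
  rw [eq_top_iff]
  rintro x -
  obtain ⟨b, rfl⟩ := Ideal.Quotient.mk_surjective x
  have hb : b ∈ Submodule.span A (Set.range g) := by rw [hg]; trivial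
  have : Submodule.span A (Set.range g) ≤
      (LinearMap.range (LinearMap.lsum A (fun _ => A ⧸ LinearMap.ker φ) A ψ)).comap
        (Ideal.Quotient.mkₐ A K).toLinearMap := by
    rw [Submodule.span_le]
    rintro _ ⟨i, rfl⟩
    refine ⟨Pi.single i (Submodule.Quotient.mk 1), ?_⟩
    rw [LinearMap.lsum_piSingle]
    refine (Submodule.liftQ_apply _ _ _).trans ?_
    simp
  exact this hb

theorem finite_aux {A B : Type*} [CommRing A] [CommRing B] [Algebra A B] [IsNoetherianRing B]
    (p : Ideal B) (hp : ∀ q : Ideal B, q.IsPrime → p ≤ q)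
    (hn : IsNoetherian A (B ⧸ p)) : IsNoetherian A B := by
  · refine IsNoetherianRing.induction_on_isQuotientEquivQuotientPrime (A := B) (M := B)
      inferInstance (motive := fun N _ _ _ => ∀ [Module A N] [IsScalarTower A B N],
        IsNoetherian A N) ?_ ?_ ?_
    · intro N _ _ _ _ _ _
      infer_instance
    · intro N _ _ _ q e _ _
      have h := hp q.1 q.2
      let f : (B ⧸ p) →ₗ[B] N := e.symm.toLinearMap ∘ₗ Submodule.factor h
      refine isNoetherian_of_surjective (f.restrictScalars A) ?_
      rw [LinearMap.range_eq_top]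
      exact e.symm.surjective.comp (Submodule.factor_surjective h)
    · intro N₁ _ _ _ N₂ _ _ _ N₃ _ _ _ f g _ _ hfg h₁ h₃ _ _
      letI : Module A N₁ := Module.compHom N₁ (algebraMap A B)
      letI : Module A N₃ := Module.compHom N₃ (algebraMap A B)
      haveI : IsScalarTower A B N₁ := IsScalarTower.of_algebraMap_smul fun _ _ => rfl
      haveI : IsScalarTower A B N₃ := IsScalarTower.of_algebraMap_smul fun _ _ => rfl
      haveI := @h₁ _ _
      haveI := @h₃ _ _
      refine isNoetherian_of_range_eq_ker (f.restrictScalars A) (g.restrictScalars A) ?_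
      ext x
      exact (hfg x).symm

/-- Let `B` be a commutative Noetherian ring which is coprimary as a module over
itself (its set of associated primes is a singleton), `S ⊆ B` a subring containing a non-zero
ideal `I` of `B`. Then `S` is Noetherian iff `B` is a finitely generated `S`-module. -/
theorem pushouts_stmt8 (B : Type*) [CommRing B] [IsNoetherianRing B]
    (p : Ideal B) (hp : associatedPrimes B B = {p})
    (S : Subring B) (I : Ideal B) (hI : I ≠ ⊥) (hIS : (I : Set B) ⊆ S) :
    IsNoetherianRing S ↔ Module.Finite S B := by
  constructor
  · intro hS
    have hmin : ∀ q : Ideal B, q.IsPrime → p ≤ q := by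
      intro q hq
      obtain ⟨r, hr, hrq⟩ := Ideal.exists_minimalPrimes_le (I := Module.annihilator B B) (J := q)
        (by
          intro x hx
          have := Module.mem_annihilator.1 hx 1
          simp only [smul_eq_mul, mul_one] at this
          rw [this]; exact q.zero_mem)
      have := Module.associatedPrimes.minimalPrimes_annihilator_subset_associatedPrimes B B hr
      rw [hp] at this
      rw [← Set.mem_singleton_iff.1 this]
      exact hrq
    have : Nontrivial I := Submodule.nontrivial_iff_ne_bot.2 hI
    obtain ⟨p', hp'⟩ := associatedPrimes.nonempty B I
    have hp2 : p' = p := by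
      have := associatedPrimes.subset_of_injective (f := I.subtype) I.subtype_injective hp'
      rw [hp] at this
      exact this
    subst hp2
    obtain ⟨-, x, hx⟩ := isAssociatedPrime_iff.1 hp'
    have hx' : ∀ b : B, b ∈ p' ↔ b * (x : B) = 0 := by
      intro b
      rw [hx]
      simp [Submodule.mem_colon_singleton, Subtype.ext_iff]
    let f : B →ₗ[S] S :=
      { toFun := fun b => ⟨b * x, hIS (I.mul_mem_left b x.2)⟩
        map_add' := fun a b => Subtype.ext (add_mul a b _)
        map_smul' := fun a b => Subtype.ext (mul_assoc (a : B) b _) }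
    have hker : LinearMap.ker f = p'.restrictScalars S := by
      ext b
      rw [LinearMap.mem_ker, Submodule.restrictScalars_mem, hx', Subtype.ext_iff]
      rfl
    have hn : IsNoetherian S (B ⧸ p'.restrictScalars S) :=
      isNoetherian_of_injective ((p'.restrictScalars S).liftQ f hker.ge)
        (LinearMap.ker_eq_bot.1 (Submodule.ker_liftQ_eq_bot _ _ _ hker.le))
    have : IsNoetherian S B := finite_aux p' hmin hn
    infer_instance
  · intro hfin
    have h := eakin_aux S B ⊥
    let f : S →ₗ[S] (B ⧸ (⊥ : Ideal B)) := (Algebra.ofId S (B ⧸ (⊥ : Ideal B))).toLinearMap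
    refine isNoetherian_of_injective f ?_
    rw [injective_iff_map_eq_zero]
    intro a ha
    have h2 : Ideal.Quotient.mk (⊥ : Ideal B) (a : B) = 0 := ha
    rw [Ideal.Quotient.eq_zero_iff_mem, Ideal.mem_bot] at h2
    exact Subtype.ext h2
end

section
/- Let B be a commutative Noetherian ring, let S ⊆ B be a subring, and suppose there exists an ideal I of B with I ⊆ S. Let P_1,...,P_n be primary ideals of B with P_1 ∩ ... ∩ P_n = 0 (a primary decomposition of the zero ideal), ordered so that I ⊆ P_i for all 1 ≤ i ≤ n' and I ⊄ P_j for all n'+1 ≤ j ≤ n. Then S is a Noetherian ring if and only if S/I is a Noetherian ring (where I is regarded as an ideal of S) and, for every n'+1 ≤ j ≤ n, the quotient B/P_j is a finitely generated module over the subring (S+P_j)/P_j of B/P_j (the image of S under the projection B → B/P_j). -/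
theorem good_mono {A M : Type*} [CommRing A] [AddCommGroup M] [Module A M] {N N' : Submodule A M}
    (h : N ≤ N') (hN : IsNoetherian A (M ⧸ N)) : IsNoetherian A (M ⧸ N') :=
  isNoetherian_of_surjective (Submodule.factor h)
    (LinearMap.range_eq_top.2 (Submodule.factor_surjective h))

theorem good_of_gt {A M : Type*} [CommRing A] [AddCommGroup M] [Module A M] {N : Submodule A M}
    (h : ∀ K, N < K → IsNoetherian A (M ⧸ K)) : IsNoetherian A (M ⧸ N) := by
  rw [isNoetherian_def]
  intro K
  by_cases hK : K = ⊥
  · rw [hK]; exact Submodule.fg_bot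
  obtain ⟨x, hx, hx0⟩ := Submodule.exists_mem_ne_zero_of_ne_bot hK
  obtain ⟨m, rfl⟩ := N.mkQ_surjective x
  have hlt : N < N ⊔ Submodule.span A {m} := by
    rw [left_lt_sup, Submodule.span_singleton_le_iff_mem]
    intro hm
    exact hx0 (by simpa using hm)
  have hg := h _ hlt
  let f : (M ⧸ N) →ₗ[A] (M ⧸ (N ⊔ Submodule.span A {m})) := Submodule.factor hlt.le
  have hk : LinearMap.ker f = Submodule.span A {N.mkQ m} := by
    apply le_antisymm
    · intro y hy
      obtain ⟨y, rfl⟩ := N.mkQ_surjective y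
      have hy' : y ∈ N ⊔ Submodule.span A {m} := by
        simpa [f] using hy
      obtain ⟨n, hn, z, hz, rfl⟩ := Submodule.mem_sup.1 hy'
      obtain ⟨a, rfl⟩ := Submodule.mem_span_singleton.1 hz
      have : N.mkQ n = 0 := by simpa using hn
      rw [map_add, this, zero_add, map_smul]
      exact Submodule.smul_mem _ _ (Submodule.mem_span_singleton_self _)
    · rw [Submodule.span_singleton_le_iff_mem]
      have : m ∈ N ⊔ Submodule.span A {m} :=
        Submodule.mem_sup_right (Submodule.mem_span_singleton_self _)
      simpa [f] using this
  refine Submodule.fg_of_fg_map_of_fg_inf_ker f (IsNoetherian.noetherian _) ?_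
  rw [hk, inf_eq_right.2 ((Submodule.span_singleton_le_iff_mem _ _).2 hx)]
  exact Submodule.fg_span_singleton _

theorem good_of_colon {A M : Type*} [CommRing A] [AddCommGroup M] [Module A M]
    [Module.Finite A M] {N N₀ : Submodule A M}
    (hc : N.colon Set.univ ≤ N₀.colon Set.univ) (hN : IsNoetherian A (M ⧸ N)) :
    IsNoetherian A (M ⧸ N₀) := by
  obtain ⟨s, hs⟩ := Module.Finite.fg_top (R := A) (M := M)
  let f : A →ₗ[A] (s → M ⧸ N) :=
    LinearMap.pi fun m => LinearMap.toSpanSingleton A (M ⧸ N) (N.mkQ m)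
  have hf : LinearMap.ker f ≤ N.colon Set.univ := by
    intro a ha
    rw [Submodule.mem_colon]
    have ha' : ∀ m ∈ s, a • m ∈ N := by
      intro m hm
      have := congrFun (LinearMap.mem_ker.1 ha) ⟨m, hm⟩
      simp only [f, LinearMap.pi_apply, LinearMap.toSpanSingleton_apply, ← map_smul] at this
      exact (Submodule.Quotient.mk_eq_zero N).1 this
    intro m _
    have hm : m ∈ Submodule.span A (s : Set M) := by rw [hs]; trivial
    induction hm using Submodule.span_induction with
    | mem x hx => exact ha' x hx
    | zero => simp
    | add x y _ _ h1 h2 => rw [smul_add]; exact N.add_mem (h1 trivial) (h2 trivial)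
    | smul b x _ h => rw [smul_comm]; exact N.smul_mem _ (h trivial)
  have h1 : IsNoetherian A (A ⧸ LinearMap.ker f) :=
    isNoetherian_of_linearEquiv f.quotKerEquivRange.symm
  let g : M → (A ⧸ LinearMap.ker f) →ₗ[A] (M ⧸ N₀) := fun m =>
    (LinearMap.ker f).liftQ (LinearMap.toSpanSingleton A (M ⧸ N₀) (N₀.mkQ m)) (by
      intro a ha
      have := Submodule.mem_colon.1 (hc (hf ha)) m trivial
      rw [LinearMap.mem_ker, LinearMap.toSpanSingleton_apply, ← map_smul]
      exact (Submodule.Quotient.mk_eq_zero N₀).2 this)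
  have h2 : (⨆ m : s, LinearMap.range (g m)) = ⊤ := by
    rw [eq_top_iff, ← N₀.range_mkQ, LinearMap.range_eq_map, ← hs, Submodule.map_span,
      Submodule.span_le]
    rintro _ ⟨m, hm, rfl⟩
    refine Submodule.mem_iSup_of_mem (⟨m, hm⟩ : s) ⟨Submodule.Quotient.mk 1, ?_⟩
    exact one_smul A (N₀.mkQ m)
  rw [← isNoetherian_top_iff, ← h2]
  infer_instance

/-- Eakin--Nagata, after Formanek -/
theorem eakin_nagata {A C : Type*} [CommRing A] [CommRing C] [Algebra A C]
    [IsNoetherianRing C] [Module.Finite A C] : IsNoetherian A C := by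
  by_contra hbad
  let T : Set (Ideal C) :=
    {K | ∃ J : Ideal A, J.map (algebraMap A C) = K ∧ ¬ IsNoetherian A (C ⧸ (J • ⊤ : Submodule A C))}
  have hT : T.Nonempty := by
    refine ⟨_, ⊥, rfl, fun h => hbad ?_⟩
    rw [Submodule.bot_smul] at h
    exact isNoetherian_of_linearEquiv (Submodule.quotEquivOfEqBot (⊥ : Submodule A C) rfl)
  obtain ⟨K, ⟨J, hJK, hJ⟩, hmax⟩ := set_has_maximal_iff_noetherian.2 ‹IsNoetherianRing C› T hT
  set N₀ : Submodule A C := J • ⊤ with hN₀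
  have hz := zorn_le_nonempty₀ {N : Submodule A C | N.colon Set.univ ≤ N₀.colon Set.univ} (by
    intro c hc hchain y hy
    refine ⟨sSup c, ?_, fun z hz => le_sSup hz⟩
    intro a ha
    obtain ⟨s, hs⟩ := Module.Finite.fg_top (R := A) (M := C)
    have h3 : ((⊤ : Submodule A C).map (LinearMap.lsmul A C a)) ≤ sSup c := by
      rintro _ ⟨x, -, rfl⟩
      exact Submodule.mem_colon.1 ha x trivial
    have hfg : ((⊤ : Submodule A C).map (LinearMap.lsmul A C a)).FG :=
      Submodule.FG.map _ ⟨s, hs⟩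
    obtain ⟨z, hz, hz'⟩ := ((Submodule.fg_iff_compact _).1 hfg)
      c _ ⟨y, hy⟩ hchain.directedOn (isLUB_sSup c) h3
    apply hc hz
    rw [Submodule.mem_colon]
    intro x _
    exact hz' ⟨x, trivial, rfl⟩) N₀ (le_refl (N₀.colon Set.univ))
  obtain ⟨N, hN0, hN⟩ := hz
  have hNbad : ¬ IsNoetherian A (C ⧸ N) := fun h => hJ (good_of_colon hN.prop h)
  apply hNbad
  apply good_of_gt
  intro K' hK'
  have : ¬ (K'.colon Set.univ ≤ N₀.colon Set.univ) := fun h => hK'.not_ge (hN.le_of_ge h hK'.le)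
  obtain ⟨a, ha, ha'⟩ := SetLike.not_le_iff_exists.1 this
  by_contra hK'bad
  have hle : ((J ⊔ Ideal.span {a}) • ⊤ : Submodule A C) ≤ K' := by
    rw [Submodule.sup_smul]
    refine sup_le (hN0.trans hK'.le) ?_
    rw [Submodule.smul_le]
    intro r hr x _
    obtain ⟨b, rfl⟩ := Ideal.mem_span_singleton'.1 hr
    rw [mul_smul]
    exact K'.smul_mem _ (Submodule.mem_colon.1 ha x trivial)
  refine hmax ((J ⊔ Ideal.span {a}).map (algebraMap A C)) ⟨_, rfl, fun h => hK'bad (good_mono hle h)⟩ ?_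
  rw [← hJK]
  refine lt_of_le_of_ne (Ideal.map_mono le_sup_left) fun heq => ha' ?_
  rw [Submodule.mem_colon]
  intro x _
  rw [hN₀, Ideal.smul_top_eq_map, heq, ← Ideal.smul_top_eq_map]
  exact Submodule.smul_mem_smul (Ideal.mem_sup_right (Ideal.mem_span_singleton_self a)) trivial

theorem good_primary {A B : Type*} [CommRing A] [CommRing B] [Algebra A B] [IsNoetherianRing B]
    (Q P : Ideal B) (hQ : IsNoetherian A (B ⧸ Q)) (k : ℕ) (hk : Q ^ k ≤ P) :
    IsNoetherian A (B ⧸ P) := by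
  by_contra hbad
  obtain ⟨J, ⟨hPJ, hJ⟩, hmax⟩ := set_has_maximal_iff_noetherian.2 ‹IsNoetherianRing B›
    {J : Ideal B | P ≤ J ∧ ¬ IsNoetherian A (B ⧸ J)} ⟨P, le_rfl, hbad⟩
  have hex : ∃ k, Q ^ k ≤ J := ⟨k, hk.trans hPJ⟩
  classical
  have hspec := Nat.find_spec hex
  have hmin := fun m => Nat.find_min hex (m := m)
  generalize Nat.find hex = m at hspec hmin
  obtain _ | m := m
  · apply hJ
    have : J = ⊤ := by simpa using hspec
    have : Subsingleton (B ⧸ J) := Ideal.Quotient.subsingleton_iff.2 this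
    infer_instance
  obtain ⟨x, hx, hxJ⟩ := SetLike.not_le_iff_exists.1 (hmin m (Nat.lt_succ_self m))
  have hlt : J < J ⊔ Ideal.span {x} := by
    rw [left_lt_sup, Ideal.span_singleton_le_iff_mem]
    exact hxJ
  have hg : IsNoetherian A (B ⧸ (J ⊔ Ideal.span {x})) := by
    by_contra h
    exact hmax _ ⟨hPJ.trans hlt.le, h⟩ hlt
  apply hJ
  let f : (B ⧸ Q) →ₗ[B] (B ⧸ J) := Submodule.mapQ Q J (LinearMap.lsmul B B x) (by
    intro q hq
    apply hspec
    rw [pow_succ]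
    exact Ideal.mul_mem_mul hx hq)
  let g : (B ⧸ J) →ₗ[B] (B ⧸ (J ⊔ Ideal.span {x})) := Submodule.factor hlt.le
  refine isNoetherian_of_range_eq_ker (f.restrictScalars A) (g.restrictScalars A) ?_
  ext y
  obtain ⟨y, rfl⟩ := Ideal.Quotient.mk_surjective y
  have e1 : g (Ideal.Quotient.mk J y) = Ideal.Quotient.mk _ y := rfl
  have e2 : ∀ b, f (Ideal.Quotient.mk Q b) = Ideal.Quotient.mk _ (x * b) := fun _ => rfl
  rw [LinearMap.mem_range, LinearMap.mem_ker]
  simp only [LinearMap.restrictScalars_apply, e1, Ideal.Quotient.eq_zero_iff_mem]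
  constructor
  · rintro ⟨b, hb⟩
    obtain ⟨b, rfl⟩ := Ideal.Quotient.mk_surjective b
    rw [e2, Ideal.Quotient.eq] at hb
    have : y = -(x * b - y) + b * x := by ring
    rw [this]
    exact Ideal.add_mem _ (Ideal.mem_sup_left (J.neg_mem hb))
      (Ideal.mem_sup_right (Ideal.mul_mem_left _ _ (Ideal.mem_span_singleton_self x)))
  · intro hy
    obtain ⟨n, hn, z, hz, rfl⟩ := Submodule.mem_sup.1 hy
    obtain ⟨a, rfl⟩ := Ideal.mem_span_singleton'.1 hz
    refine ⟨Ideal.Quotient.mk Q a, ?_⟩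
    rw [e2, Ideal.Quotient.eq]
    have : x * a - (n + a * x) = - n := by ring
    rw [this]
    exact J.neg_mem hn

theorem finite_map_iff {B : Type*} [CommRing B] (S : Subring B) (P : Ideal B) :
    Module.Finite (S.map (Ideal.Quotient.mk P)) (B ⧸ P) ↔ Module.Finite S (B ⧸ P) := by
  let φ : S →+* S.map (Ideal.Quotient.mk P) :=
    ((Ideal.Quotient.mk P).comp S.subtype).codRestrict _ fun x => ⟨x, x.2, rfl⟩
  have hφ : Function.Surjective φ := by
    rintro ⟨_, x, hx, rfl⟩
    exact ⟨⟨x, hx⟩, rfl⟩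
  let _ := φ.toAlgebra
  have : IsScalarTower S (S.map (Ideal.Quotient.mk P)) (B ⧸ P) :=
    IsScalarTower.of_algebraMap_eq fun _ => rfl
  constructor
  · intro h
    have : Module.Finite S (S.map (Ideal.Quotient.mk P)) :=
      Module.Finite.of_surjective (Algebra.linearMap S (S.map (Ideal.Quotient.mk P))) hφ
    exact Module.Finite.trans (S.map (Ideal.Quotient.mk P)) _
  · intro h
    exact Module.Finite.of_restrictScalars_finite S _ _

theorem noeth_quot {A : Type*} [CommRing A] (J : Ideal A) (h : IsNoetherianRing (A ⧸ J)) :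
    IsNoetherian A (A ⧸ J) := by
  let ψ : (A ⧸ J) →ₛₗ[Ideal.Quotient.mk J] (A ⧸ J) :=
    { toFun := id
      map_add' := fun _ _ => rfl
      map_smul' := fun a b => by
        obtain ⟨b, rfl⟩ := Ideal.Quotient.mk_surjective b
        rfl }
  have : RingHomSurjective (Ideal.Quotient.mk J) := ⟨Ideal.Quotient.mk_surjective⟩
  exact (LinearMap.isNoetherian_iff_of_bijective ψ Function.bijective_id).2 h

theorem noeth_ideal {B : Type*} [CommRing B] (S : Subring B) (I : Ideal B)
    {ι : Type*} [Finite ι] (P : ι → Ideal B) (h : ∀ j, IsNoetherian S (B ⧸ P j))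
    (h0 : ∀ x ∈ I, (∀ j, x ∈ P j) → x = 0) :
    IsNoetherian S (Ideal.comap S.subtype I) := by
  let q : ∀ j, S →ₗ[S] (B ⧸ P j) := fun j => Algebra.linearMap S (B ⧸ P j)
  let g : (Ideal.comap S.subtype I) →ₗ[S] (∀ j, B ⧸ P j) :=
    (LinearMap.pi q).comp (Submodule.subtype _)
  refine isNoetherian_of_ker_bot g ?_
  rw [eq_bot_iff]
  rintro ⟨⟨x, hxS⟩, hxI⟩ hx
  have hx0 : x = 0 := h0 x hxI fun j => by
    have := congrFun (LinearMap.mem_ker.1 hx) j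
    exact Ideal.Quotient.eq_zero_iff_mem.1 this
  subst hx0
  rfl

/-- Let `B` be Noetherian, `S ⊆ B` a subring containing an ideal `I` of `B`,
and `P_1, …, P_n` primary ideals of `B` with `P_1 ∩ … ∩ P_n = 0`, ordered so that `I ⊆ P_i`
for `i < n'` and `I ⊄ P_j` for `n' ≤ j`. Then `S` is Noetherian iff `S/I` is Noetherian and,
for each `j` with `n' ≤ j`, `B/P_j` is a finitely generated module over the image
`(S+P_j)/P_j` of `S` in `B/P_j`. -/
theorem pushouts_stmt9 (B : Type*) [CommRing B] [IsNoetherianRing B]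
    (S : Subring B) (I : Ideal B) (hIS : (I : Set B) ⊆ S)
    (n n' : ℕ) (hn : n' ≤ n) (P : Fin n → Ideal B)
    (hprim : ∀ i, (P i).IsPrimary) (hdec : (⨅ i, P i) = ⊥)
    (hle : ∀ i : Fin n, (i : ℕ) < n' → I ≤ P i)
    (hnle : ∀ i : Fin n, n' ≤ (i : ℕ) → ¬ I ≤ P i) :
    IsNoetherianRing S ↔
      (IsNoetherianRing (S ⧸ Ideal.comap S.subtype I) ∧
        ∀ i : Fin n, n' ≤ (i : ℕ) →
          Module.Finite (S.map (Ideal.Quotient.mk (P i))) (B ⧸ P i)) := by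
  simp only [finite_map_iff]
  constructor
  · intro hS
    refine ⟨inferInstance, fun i hi => ?_⟩
    obtain ⟨x, hxI, hxP⟩ := SetLike.not_le_iff_exists.1 (hnle i hi)
    obtain ⟨k, hk⟩ := (P i).exists_radical_pow_le_of_fg (Ideal.fg_of_isNoetherianRing _)
    let f : B →ₗ[S] S :=
      { toFun := fun b => ⟨b * x, hIS (I.mul_mem_left b hxI)⟩
        map_add' := fun a b => Subtype.ext (add_mul a b x)
        map_smul' := fun a b => Subtype.ext (mul_assoc (a : B) b x) }
    have h1 : IsNoetherian S (B ⧸ LinearMap.ker f) :=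
      isNoetherian_of_linearEquiv f.quotKerEquivRange.symm
    have hle' : LinearMap.ker f ≤ LinearMap.ker (Ideal.Quotient.mkₐ S (P i).radical).toLinearMap := by
      intro b hb
      have hb' : b * x = 0 := congrArg Subtype.val (LinearMap.mem_ker.1 hb)
      have := (Ideal.isPrimary_iff.1 (hprim i)).2 (x := x) (y := b)
        (by rw [mul_comm, hb']; exact zero_mem _)
      exact Ideal.Quotient.eq_zero_iff_mem.2 (this.resolve_left hxP)
    have h2 : IsNoetherian S (B ⧸ (P i).radical) := by
      refine isNoetherian_of_surjective ((LinearMap.ker f).liftQ _ hle') ?_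
      rw [Submodule.range_liftQ, LinearMap.range_eq_top]
      exact Ideal.Quotient.mk_surjective
    have h3 := good_primary (A := S) _ _ h2 k hk
    infer_instance
  · rintro ⟨h1, h2⟩
    have h3 : ∀ j : {i : Fin n // n' ≤ (i : ℕ)}, IsNoetherian S (B ⧸ P j) := fun j => by
      have := h2 j j.2
      exact eakin_nagata
    rw [isNoetherianRing_iff, isNoetherian_iff_submodule_quotient (Ideal.comap S.subtype I)]
    refine ⟨noeth_ideal S I (fun j : {i : Fin n // n' ≤ (i : ℕ)} => P j) h3 ?_, noeth_quot _ h1⟩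
    intro x hxI hx
    rw [← Ideal.mem_bot, ← hdec, Ideal.mem_iInf]
    intro i
    by_cases hi : n' ≤ (i : ℕ)
    · exact hx ⟨i, hi⟩
    · exact hle i (not_le.1 hi) hxI
end

section
/- Let B be a commutative Noetherian ring, let S ⊆ B be a subring, and let I, J be ideals of B. If B is a finitely generated module over the subring S+I and over the subring S+J, then B is a finitely generated module over each of the subrings S+(I+J), S+(I∩J), and (S+I) ∩ (S+J); moreover, all of these subrings are Noetherian rings. -/
/-- For a subring `S` of a commutative ring `B` and an ideal `I` of `B`, the subring
`S + I = {s + i : s ∈ S, i ∈ I}` of `B`. -/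
def Subring.addIdeal {B : Type*} [CommRing B] (S : Subring B) (I : Ideal B) : Subring B where
  carrier := {x : B | ∃ s ∈ S, ∃ i ∈ I, x = s + i}
  zero_mem' := ⟨0, S.zero_mem, 0, I.zero_mem, by ring⟩
  one_mem' := ⟨1, S.one_mem, 0, I.zero_mem, by ring⟩
  add_mem' := by
    rintro a b ⟨s, hs, i, hi, rfl⟩ ⟨t, ht, j, hj, rfl⟩
    exact ⟨s + t, S.add_mem hs ht, i + j, I.add_mem hi hj, by ring⟩
  neg_mem' := by
    rintro a ⟨s, hs, i, hi, rfl⟩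
    exact ⟨-s, S.neg_mem hs, -i, neg_mem hi, by ring⟩
  mul_mem' := by
    rintro a b ⟨s, hs, i, hi, rfl⟩ ⟨t, ht, j, hj, rfl⟩
    exact ⟨s * t, S.mul_mem hs ht,
      s * j + i * t + i * j,
      I.add_mem (I.add_mem (I.mul_mem_left s hj) (I.mul_mem_right t hi)) (I.mul_mem_left i hj),
      by ring⟩

theorem formanek_step {A M : Type*} [CommRing A] [AddCommGroup M] [Module A M] [Module.Finite A M]
    (h : ∀ a : A, (¬ ∀ x : M, a • x = 0) → ∀ P : Submodule A M, (∀ x : M, a • x ∈ P) → P.FG) :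
    IsNoetherian A M := by
  obtain ⟨n, f, hf⟩ := Module.Finite.exists_fin' A M
  let e : Fin n → M := fun i => f (Pi.single i 1)
  have hfe : ∀ v, f v = ∑ i, v i • e i := by
    intro v
    conv_lhs => rw [pi_eq_sum_univ' v]
    simp only [map_sum, map_smul, e]
  have key : ∀ (P : Submodule A M) (a : A), (∀ i, a • e i ∈ P) → ∀ x, a • x ∈ P := by
    intro P a ha x
    obtain ⟨v, rfl⟩ := hf x
    rw [hfe, Finset.smul_sum]
    refine P.sum_mem fun i _ => ?_
    rw [smul_comm]
    exact P.smul_mem _ (ha i)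
  let T : Set (Submodule A M) := {N | ∀ a : A, (∀ x : M, a • x ∈ N) → ∀ x : M, a • x = 0}
  have hbot : (⊥ : Submodule A M) ∈ T := fun a ha x => by simpa using ha x
  obtain ⟨N, -, hN⟩ := zorn_le_nonempty₀ T (by
    intro c hc hchain y hy
    refine ⟨sSup c, ?_, fun z hz => le_sSup hz⟩
    intro a ha
    have hd : DirectedOn (· ≤ ·) c := hchain.directedOn
    have : ∀ i, ∃ N ∈ c, a • e i ∈ N := fun i =>
      (Submodule.mem_sSup_of_directed ⟨y, hy⟩ hd).1 (ha (e i))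
    choose g hg hg' using this
    have : ∃ N ∈ c, ∀ i ∈ (Finset.univ : Finset (Fin n)), g i ≤ N := by
      classical
      induction (Finset.univ : Finset (Fin n)) using Finset.induction_on with
      | empty => exact ⟨y, hy, by simp⟩
      | insert i s _ ih =>
        obtain ⟨N, hNc, hN⟩ := ih
        obtain ⟨N', hN'c, h1, h2⟩ := hd N hNc (g i) (hg i)
        refine ⟨N', hN'c, ?_⟩
        intro j hj
        rcases Finset.mem_insert.1 hj with rfl | hj
        · exact h2
        · exact (hN j hj).trans h1
    obtain ⟨N, hNc, hN⟩ := this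
    exact hc hNc a (key N a fun i => hN i (Finset.mem_univ i) (hg' i))) ⊥ hbot
  have hNoeth : IsNoetherian A (M ⧸ N) := by
    refine ⟨fun P => ?_⟩
    by_cases hP : P = ⊥
    · rw [hP]; exact Submodule.fg_bot
    have hlt : N < P.comap N.mkQ := by
      refine lt_of_le_of_ne ?_ ?_
      · intro x hx
        have : N.mkQ x = 0 := by simpa using hx
        simp [Submodule.mem_comap, (Submodule.Quotient.mk_eq_zero N).2 hx]
      · intro heq
        apply hP
        rw [eq_bot_iff]
        intro z hz
        obtain ⟨x, rfl⟩ := N.mkQ_surjective z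
        have : x ∈ N := by rw [heq]; exact hz
        simpa using this
    have hnT : P.comap N.mkQ ∉ T := fun hT => hlt.not_ge (hN.2 hT hlt.le)
    simp only [T, Set.mem_ofPred_eq, not_forall] at hnT
    obtain ⟨a, ha, x, hx⟩ := hnT
    have := (h a (fun h => hx (h x)) _ ha).map N.mkQ
    rwa [Submodule.map_comap_eq_self (by simp)] at this
  -- the ring acts through a Noetherian quotient
  let φ : A →ₗ[A] (Fin n → M ⧸ N) := LinearMap.pi fun i => LinearMap.toSpanSingleton A _ (N.mkQ (e i))
  have hQ : IsNoetherian A (A ⧸ LinearMap.ker φ) :=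
    isNoetherian_of_linearEquiv φ.quotKerEquivRange.symm
  have hker : ∀ a ∈ LinearMap.ker φ, ∀ x : M, a • x = 0 := by
    intro a ha
    refine hN.1 a (key N a fun i => ?_)
    have := congrFun (LinearMap.mem_ker.1 ha) i
    have h2 : N.mkQ (a • e i) = 0 := by simpa [φ] using this
    exact (Submodule.Quotient.mk_eq_zero N).1 h2
  let ψ : (Fin n → A ⧸ LinearMap.ker φ) →ₗ[A] M :=
    LinearMap.lsum A _ A fun i => (LinearMap.ker φ).liftQ (LinearMap.toSpanSingleton A M (e i))
      (fun a ha => by simpa using hker a ha (e i))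
  refine isNoetherian_of_surjective ψ (LinearMap.range_eq_top.2 fun x => ?_)
  obtain ⟨v, rfl⟩ := hf x
  refine ⟨fun i => (LinearMap.ker φ).mkQ (v i), ?_⟩
  rw [hfe]
  simp only [ψ, LinearMap.lsum_apply, LinearMap.sum_apply, LinearMap.comp_apply,
    LinearMap.proj_apply, Submodule.mkQ_apply, Submodule.liftQ_apply,
    LinearMap.toSpanSingleton_apply]

theorem eakin_nagata_module (A B : Type*) [CommRing A] [CommRing B] [Algebra A B]
    [IsNoetherianRing B] [Module.Finite A B] : IsNoetherian A B := by
  have main : ∀ K : Ideal B, IsNoetherian A (B ⧸ K) := by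
    intro K
    induction K using IsNoetherian.induction with
    | hgt K ih =>
    refine formanek_step fun a ha P hP => ?_
    let K' : Ideal B := K ⊔ Ideal.span {algebraMap A B a}
    have hle : K ≤ K' := le_sup_left
    have hlt : K < K' := by
      refine lt_of_le_of_ne hle fun heq => ha fun x => ?_
      have hmem : algebraMap A B a ∈ K := by
        rw [heq]; exact Ideal.mem_sup_right (Ideal.subset_span rfl)
      obtain ⟨b, rfl⟩ := Ideal.Quotient.mk_surjective x
      rw [Algebra.smul_def, IsScalarTower.algebraMap_apply A B (B ⧸ K),
        Ideal.Quotient.algebraMap_eq, Ideal.Quotient.eq_zero_iff_mem.2 hmem, zero_mul]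
    have := ih K' hlt
    let g : (B ⧸ K) →ₗ[A] (B ⧸ K') := (Ideal.Quotient.factorₐ A hle).toLinearMap
    refine Submodule.fg_of_fg_map_of_fg_inf_ker g (IsNoetherian.noetherian _) ?_
    have hr : P ⊓ LinearMap.ker g = LinearMap.range (LinearMap.lsmul A (B ⧸ K) a) := by
      apply le_antisymm
      · rintro x ⟨-, hx⟩
        obtain ⟨b, rfl⟩ := Ideal.Quotient.mk_surjective x
        have hb : Ideal.Quotient.mk K' b = 0 := hx
        rw [Ideal.Quotient.eq_zero_iff_mem] at hb
        obtain ⟨k, hk, y, hy, rfl⟩ := Submodule.mem_sup.1 hb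
        obtain ⟨c, rfl⟩ := Ideal.mem_span_singleton'.1 hy
        refine ⟨Ideal.Quotient.mk K c, ?_⟩
        rw [map_add, Ideal.Quotient.eq_zero_iff_mem.2 hk, zero_add, map_mul, LinearMap.lsmul_apply,
          Algebra.smul_def, IsScalarTower.algebraMap_apply A B (B ⧸ K),
          Ideal.Quotient.algebraMap_eq, mul_comm]
      · rintro _ ⟨x, rfl⟩
        refine ⟨hP x, ?_⟩
        obtain ⟨b, rfl⟩ := Ideal.Quotient.mk_surjective x
        change Ideal.Quotient.mk K' (a • b) = 0
        rw [Ideal.Quotient.eq_zero_iff_mem, Algebra.smul_def]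
        exact Ideal.mul_mem_right _ _ (Ideal.mem_sup_right (Ideal.subset_span rfl))
    rw [hr, LinearMap.range_eq_map]
    exact Module.Finite.fg_top.map _
  have := main ⊥
  exact isNoetherian_of_injective (Ideal.Quotient.mkₐ A (⊥ : Ideal B)).toLinearMap
    (fun x y hxy => by
      have : Ideal.Quotient.mk (⊥ : Ideal B) x = Ideal.Quotient.mk ⊥ y := hxy
      rw [Ideal.Quotient.eq] at this
      exact sub_eq_zero.1 (by simpa using this))

theorem eakin_nagata_subring {B : Type*} [CommRing B] [IsNoetherianRing B] (A : Subring B)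
    [Module.Finite A B] : IsNoetherianRing A := by
  have := eakin_nagata_module A B
  exact isNoetherian_of_injective (Algebra.linearMap A B) Subtype.val_injective

theorem finite_of_le {B : Type*} [CommRing B] {A C : Subring B} (h : A ≤ C)
    (hA : Module.Finite A B) : Module.Finite C B := by
  obtain ⟨s, hs⟩ := hA.fg_top
  refine ⟨⟨s, ?_⟩⟩
  rw [eq_top_iff]
  intro x _
  have hx : x ∈ Submodule.span A (s : Set B) := by rw [hs]; trivial
  induction hx using Submodule.span_induction with
  | mem x hx => exact Submodule.subset_span hx
  | zero => exact Submodule.zero_mem _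
  | add x y _ _ hx hy => exact Submodule.add_mem _ (hx trivial) (hy trivial)
  | smul a x _ hx => exact Submodule.smul_mem _ (⟨a, h a.2⟩ : C) (hx trivial)

theorem noeth_quot_s11 {B : Type*} [CommRing B] [IsNoetherianRing B] (S C : Subring B) (I : Ideal B)
    (hSC : S ≤ C) [Module.Finite (S.addIdeal I) B] : IsNoetherian C (B ⧸ I) := by
  have h1 := eakin_nagata_module (S.addIdeal I) B
  have h2 : IsNoetherian (S.addIdeal I) (B ⧸ I) :=
    isNoetherian_of_surjective (Ideal.Quotient.mkₐ (S.addIdeal I) I).toLinearMap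
      (LinearMap.range_eq_top.2 Ideal.Quotient.mk_surjective)
  let F : Submodule C (B ⧸ I) → Submodule (S.addIdeal I) (B ⧸ I) := fun P =>
    { carrier := P
      add_mem' := P.add_mem
      zero_mem' := P.zero_mem
      smul_mem' := by
        rintro ⟨_, s, hs, i, hi, rfl⟩ x hx
        obtain ⟨b, rfl⟩ := Ideal.Quotient.mk_surjective x
        have : (⟨s, hSC hs⟩ : C) • Ideal.Quotient.mk I b ∈ P := P.smul_mem _ hx
        suffices hh : Ideal.Quotient.mk I ((s + i) * b) = Ideal.Quotient.mk I (s * b) by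
          change Ideal.Quotient.mk I ((s + i) * b) ∈ P
          rw [hh]
          exact this
        change Ideal.Quotient.mk I ((s + i) * b) = Ideal.Quotient.mk I (s * b)
        rw [Ideal.Quotient.eq]
        have : (s + i) * b - s * b = i * b := by ring
        rw [this]
        exact I.mul_mem_right _ hi }
  rw [isNoetherian_iff'] at h2 ⊢
  have hF : StrictMono F := fun P Q hPQ => hPQ
  exact hF.wellFoundedGT

theorem finite_inf {B : Type*} [CommRing B] [IsNoetherianRing B] (S : Subring B) (I J : Ideal B)
    (hI : Module.Finite (S.addIdeal I) B) (hJ : Module.Finite (S.addIdeal J) B) :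
    Module.Finite (S.addIdeal (I ⊓ J)) B := by
  set C := S.addIdeal (I ⊓ J) with hC
  have hSC : S ≤ C := fun s hs => ⟨s, hs, 0, Ideal.zero_mem _, by ring⟩
  have hKC : ∀ k ∈ I ⊓ J, k ∈ C := fun k hk => ⟨0, S.zero_mem, k, hk, by ring⟩
  have := noeth_quot_s11 S C I hSC
  have := noeth_quot_s11 S C J hSC
  let q : B →ₗ[C] (B ⧸ I) × (B ⧸ J) :=
    (Ideal.Quotient.mkₐ C I).toLinearMap.prod (Ideal.Quotient.mkₐ C J).toLinearMap
  have hq : ∀ x, q x = 0 → x ∈ I ⊓ J := by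
    intro x hx
    have h1 : Ideal.Quotient.mk I x = 0 := congrArg Prod.fst hx
    have h2 : Ideal.Quotient.mk J x = 0 := congrArg Prod.snd hx
    exact ⟨Ideal.Quotient.eq_zero_iff_mem.1 h1, Ideal.Quotient.eq_zero_iff_mem.1 h2⟩
  have hfg : (LinearMap.range q).FG := IsNoetherian.noetherian _
  obtain ⟨T, hT, hTq⟩ : ∃ T : Submodule C B, T.FG ∧ T.map q = LinearMap.range q := by
    obtain ⟨s, hs⟩ := hfg
    have hsub : (s : Set ((B ⧸ I) × (B ⧸ J))) ⊆ Set.range q := by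
      intro x hx
      have : x ∈ LinearMap.range q := hs ▸ Submodule.subset_span hx
      exact this
    choose g hg using hsub
    refine ⟨Submodule.span C (Set.range fun x : s => g x.2), 
      Submodule.fg_span (Set.finite_range _), ?_⟩
    rw [Submodule.map_span, ← hs]
    congr 1
    ext y
    constructor
    · rintro ⟨_, ⟨x, rfl⟩, rfl⟩
      change q (g x.2) ∈ _
      rw [hg]; exact x.2
    · intro hy
      exact ⟨_, ⟨⟨y, hy⟩, rfl⟩, hg hy⟩
  have hdec : ∀ b : B, ∃ t ∈ T, ∃ k ∈ I ⊓ J, b = t + k := by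
    intro b
    have : q b ∈ T.map q := by rw [hTq]; exact ⟨b, rfl⟩
    obtain ⟨t, ht, htb⟩ := this
    exact ⟨t, ht, b - t, hq _ (by rw [map_sub, htb, sub_self]), by ring⟩
  obtain ⟨ks, hks⟩ := IsNoetherian.noetherian (I ⊓ J : Ideal B)
  let G : Submodule C B := Submodule.span C (ks : Set B)
  let T' : Submodule C B := T ⊔ Submodule.span C {1}
  have hT' : T'.FG := hT.sup (Submodule.fg_span_singleton 1)
  have hTG : (T' * G).FG := hT'.mul (Submodule.fg_span ks.finite_toSet)
  have hK : ∀ k ∈ I ⊓ J, ∀ b, b * k ∈ T' * G := by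
    intro k hk
    rw [← hks] at hk
    induction hk using Submodule.span_induction with
    | mem x hx =>
      intro b
      have hxG : x ∈ G := Submodule.subset_span hx
      obtain ⟨t, ht, k, hk, rfl⟩ := hdec b
      rw [add_mul]
      refine Submodule.add_mem _ (Submodule.mul_mem_mul (Submodule.mem_sup_left ht) hxG) ?_
      refine Submodule.mul_mem_mul (Submodule.mem_sup_right ?_) hxG
      exact Submodule.mem_span_singleton.2 ⟨⟨k, hKC k hk⟩, mul_one k⟩
    | zero => intro b; rw [mul_zero]; exact Submodule.zero_mem _
    | add x y _ _ hx hy => intro b; rw [mul_add]; exact Submodule.add_mem _ (hx b) (hy b)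
    | smul a x _ hx => intro b; rw [smul_eq_mul, ← mul_assoc]; exact hx _
  have htop : (⊤ : Submodule C B) = T ⊔ T' * G := by
    symm
    rw [eq_top_iff]
    intro b _
    obtain ⟨t, ht, k, hk, rfl⟩ := hdec b
    refine Submodule.add_mem_sup ht ?_
    simpa using hK k hk 1
  exact ⟨htop ▸ hT.sup hTG⟩

/-- Let `B` be Noetherian, `S ⊆ B` a subring and `I, J` ideals of `B`.
If `B` is a finitely generated module over `S+I` and over `S+J`, then `B` is a finitely
generated module over `S+(I+J)`, over `S+(I∩J)` and over `(S+I)∩(S+J)`, and all of these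
subrings are Noetherian. -/
theorem pushouts_stmt11 (B : Type*) [CommRing B] [IsNoetherianRing B]
    (S : Subring B) (I J : Ideal B)
    (hI : Module.Finite (S.addIdeal I) B) (hJ : Module.Finite (S.addIdeal J) B) :
    Module.Finite (S.addIdeal (I ⊔ J)) B ∧
    Module.Finite (S.addIdeal (I ⊓ J)) B ∧
    Module.Finite (S.addIdeal I ⊓ S.addIdeal J : Subring B) B ∧
    IsNoetherianRing (S.addIdeal (I ⊔ J)) ∧
    IsNoetherianRing (S.addIdeal (I ⊓ J)) ∧
    IsNoetherianRing (S.addIdeal I ⊓ S.addIdeal J : Subring B) := by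
  have h1 : Module.Finite (S.addIdeal (I ⊔ J)) B := finite_of_le
    (by rintro _ ⟨s, hs, i, hi, rfl⟩; exact ⟨s, hs, i, Ideal.mem_sup_left hi, rfl⟩) hI
  have h2 := finite_inf S I J hI hJ
  have h3 : Module.Finite (S.addIdeal I ⊓ S.addIdeal J : Subring B) B := finite_of_le
    (by
      rintro _ ⟨s, hs, i, hi, rfl⟩
      exact ⟨⟨s, hs, i, hi.1, rfl⟩, ⟨s, hs, i, hi.2, rfl⟩⟩) h2
  exact ⟨h1, h2, h3, eakin_nagata_subring _, eakin_nagata_subring _, eakin_nagata_subring _⟩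
end

section
/- Let B be a commutative Noetherian ring, let S ⊆ B be a subring, and let I, J be ideals of B. If both subrings S+I and S+J are Noetherian rings, then the subring S+(I+J) is a Noetherian ring. -/
/-- Let `B` be Noetherian, `S ⊆ B` a subring and `I, J` ideals of `B`.
If the subrings `S+I` and `S+J` are Noetherian, then so is `S+(I+J)`. -/
theorem pushouts_stmt12 (B : Type*) [CommRing B] [IsNoetherianRing B]
    (S : Subring B) (I J : Ideal B)
    (hI : IsNoetherianRing (S.addIdeal I)) (hJ : IsNoetherianRing (S.addIdeal J)) :
    IsNoetherianRing (S.addIdeal (I ⊔ J)) := by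
  have h1 : S.addIdeal I ≤ S.addIdeal (I ⊔ J) := by
    rintro x ⟨s, hs, i, hi, rfl⟩
    exact ⟨s, hs, i, Ideal.mem_sup_left hi, rfl⟩
  have h2 : S.addIdeal J ≤ S.addIdeal (I ⊔ J) := by
    rintro x ⟨s, hs, i, hi, rfl⟩
    exact ⟨s, hs, i, Ideal.mem_sup_right hi, rfl⟩
  let K : Ideal (S.addIdeal (I ⊔ J)) := I.comap (S.addIdeal (I ⊔ J)).subtype
  have hK : IsNoetherian (S.addIdeal (I ⊔ J)) K := by
    let _ : Algebra (S.addIdeal I) (S.addIdeal (I ⊔ J)) := (Subring.inclusion h1).toAlgebra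
    let f : K →ₗ[S.addIdeal I] S.addIdeal I :=
      { toFun := fun x => ⟨x.1.1, 0, S.zero_mem, x.1.1, x.2, by ring⟩
        map_add' := fun x y => rfl
        map_smul' := fun a x => rfl }
    have hf : Function.Injective f := by
      intro x y h
      have h3 : (f x).1 = (f y).1 := congrArg Subtype.val h
      exact Subtype.ext (Subtype.ext h3)
    have : IsNoetherian (S.addIdeal I) K := isNoetherian_of_injective f hf
    exact isNoetherian_of_tower (S.addIdeal I) this
  have hQ : IsNoetherian (S.addIdeal (I ⊔ J)) (S.addIdeal (I ⊔ J) ⧸ K) := by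
    let _ : Algebra (S.addIdeal J) (S.addIdeal (I ⊔ J)) := (Subring.inclusion h2).toAlgebra
    let f : S.addIdeal J →ₗ[S.addIdeal J] (S.addIdeal (I ⊔ J) ⧸ K) :=
      (Algebra.linearMap (S.addIdeal J) (S.addIdeal (I ⊔ J) ⧸ K))
    have hf : Function.Surjective f := by
      intro q
      obtain ⟨⟨x, s, hs, t, ht, rfl⟩, rfl⟩ := Ideal.Quotient.mk_surjective q
      obtain ⟨i, hi, j, hj, rfl⟩ := Submodule.mem_sup.1 ht
      refine ⟨⟨s + j, s, hs, j, hj, rfl⟩, ?_⟩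
      refine (Ideal.Quotient.eq (I := K)
        (x := ⟨s + j, h2 ⟨s, hs, j, hj, rfl⟩⟩)).2 ?_
      change (s + j) - (s + (i + j)) ∈ I
      have : (s + j) - (s + (i + j)) = -i := by ring
      rw [this]
      exact neg_mem hi
    have : IsNoetherian (S.addIdeal J) (S.addIdeal (I ⊔ J) ⧸ K) :=
      isNoetherian_of_surjective f (LinearMap.range_eq_top.2 hf)
    exact isNoetherian_of_tower (S.addIdeal J) this
  exact (isNoetherian_iff_submodule_quotient K).2 ⟨hK, hQ⟩
end

section
/- Let B be a commutative Noetherian ring, let S ⊆ B be a subring, and let I, J be ideals of B. If both subrings S+I and S+J are Noetherian rings, then the subrings S+(I∩J) and (S+I) ∩ (S+J) are Noetherian rings. -/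
namespace PO

variable {A B : Type*} [CommRing A] [CommRing B] [Algebra A B]

/-- restriction of scalars of an ideal -/
abbrev rs (A : Type*) {B : Type*} [CommRing A] [CommRing B] [Algebra A B] (I : Ideal B) :
    Submodule A B := Submodule.restrictScalars A I

/-- relative Noetherianity -/
def NN (N M : Submodule A B) : Prop :=
  ∀ Q : Submodule A B, Q ≤ M → ∃ F : Submodule A B, F.FG ∧ F ≤ Q ∧ Q ≤ F ⊔ N

lemma NN.trans {L N M : Submodule A B} (h1 : NN L N) (h2 : NN N M) : NN L M := by
  intro Q hQ
  obtain ⟨F, hF, hFQ, hQF⟩ := h2 Q hQ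
  obtain ⟨G, hG, hGQ, hQG⟩ := h1 (Q ⊓ N) inf_le_right
  refine ⟨F ⊔ G, hF.sup hG, sup_le hFQ (hGQ.trans inf_le_left), ?_⟩
  have : Q ≤ F ⊔ N ⊓ Q := by
    rw [← sup_inf_assoc_of_le N hFQ]
    exact le_inf hQF le_rfl
  rw [inf_comm] at this
  refine this.trans (sup_le (le_sup_left.trans le_sup_left) (hQG.trans ?_))
  rw [sup_assoc]
  exact le_sup_right

lemma rs_mul_rs (I J : Ideal B) : rs A I * rs A J ≤ rs A (I * J) := by
  rw [Submodule.mul_le]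
  intro m hm n hn
  exact Ideal.mul_mem_mul hm hn

lemma rs_pow (I : Ideal B) (n : ℕ) : (rs A I) ^ (n + 1) ≤ rs A (I ^ (n + 1)) := by
  induction n with
  | zero => simp
  | succ n ih =>
    rw [pow_succ, pow_succ I (n+1)]
    exact (mul_le_mul' ih le_rfl).trans (rs_mul_rs _ _)

lemma rs_pow_le (I : Ideal B) (n : ℕ) : (rs A I) ^ n ≤ 1 ⊔ rs A I := by
  cases n with
  | zero => simp
  | succ n =>
    refine (rs_pow I n).trans (le_trans ?_ le_sup_right)
    intro x hx
    exact Ideal.pow_le_self (Nat.succ_ne_zero n) hx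

/-- key property -/
def HH (A : Type*) {B : Type*} [CommRing A] [CommRing B] [Algebra A B] (I : Ideal B) : Prop :=
  ∀ Q : Submodule A B, Q ≤ 1 ⊔ rs A I → ∃ F : Submodule A B, F.FG ∧ F ≤ Q ∧ Q ≤ F ⊔ rs A I * Q

lemma HH.nn {I : Ideal B} (h : HH A I) (n : ℕ) : NN ((rs A I) ^ n) 1 := by
  induction n with
  | zero =>
    intro Q hQ
    exact ⟨⊥, Submodule.fg_bot, bot_le, by simpa using hQ⟩
  | succ n ih =>
    refine NN.trans ?_ ih
    intro Q hQ
    obtain ⟨F, hF, h1, h2⟩ := h Q (hQ.trans (rs_pow_le I n))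
    refine ⟨F, hF, h1, h2.trans (sup_le_sup le_rfl ?_)⟩
    rw [pow_succ']
    exact mul_le_mul' le_rfl hQ

lemma artin_rees [IsNoetherianRing B] (I N : Ideal B) : ∃ n : ℕ, I ^ (n + 1) ⊓ N ≤ I * N := by
  obtain ⟨k, hk⟩ := Ideal.exists_pow_inf_eq_pow_smul I (N : Submodule B B)
  refine ⟨k, ?_⟩
  have := hk (k + 1) (Nat.le_succ k)
  simp only [smul_eq_mul, Ideal.mul_top, Nat.add_sub_cancel_left, pow_one] at this
  rw [this]
  exact Ideal.mul_mono_right inf_le_right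

lemma HH.ar [IsNoetherianRing B] {I : Ideal B} (h : HH A I) (N : Ideal B) (Q : Submodule A B)
    (hQ : Q ≤ 1) (hN : Q ≤ rs A N) :
    ∃ F : Submodule A B, F.FG ∧ F ≤ Q ∧ Q ≤ F ⊔ (rs A (I * N) ⊓ Q) := by
  obtain ⟨n, hn⟩ := artin_rees I N
  obtain ⟨F, hF, h1, h2⟩ := h.nn (n + 1) Q hQ
  refine ⟨F, hF, h1, ?_⟩
  have : Q ≤ F ⊔ (rs A I) ^ (n + 1) ⊓ Q := by
    rw [← sup_inf_assoc_of_le _ h1]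
    exact le_inf h2 le_rfl
  refine this.trans (sup_le_sup le_rfl (le_inf ?_ inf_le_right))
  intro x hx
  exact hn ⟨rs_pow (A := A) I n hx.1, hN hx.2⟩

lemma mul_span_le (K : Ideal B) (t : Set B) :
    rs A (K * Ideal.span t) ≤ rs A K * Submodule.span A t := by
  intro x hx
  have hx : x ∈ K * Ideal.span t := hx
  refine Submodule.mul_induction_on hx ?_ (fun x y hx hy => add_mem hx hy)
  intro k hk y hy
  induction hy using Submodule.span_induction generalizing k with
  | mem y hy => exact Submodule.mul_mem_mul hk (Submodule.subset_span hy)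
  | zero => simp
  | add y z _ _ h1 h2 => rw [mul_add]; exact add_mem (h1 k hk) (h2 k hk)
  | smul b y _ h =>
    rw [smul_eq_mul, ← mul_assoc]
    exact h _ (K.mul_mem_right b hk)

lemma step [IsNoetherianRing B] {I J : Ideal B} (hI : HH A I) (hJ : HH A J)
    (N : Ideal B) (Q : Submodule A B) (hQ : Q ≤ 1) (hN : Q ≤ rs A N) :
    ∃ F : Submodule A B, F.FG ∧ F ≤ Q ∧ Q ≤ F ⊔ rs A ((I ⊓ J) * N) := by
  obtain ⟨F, hF, h1, h2⟩ := hI.ar N Q hQ hN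
  obtain ⟨G, hG, h3, h4⟩ := hJ.ar (I * N) (rs A (I * N) ⊓ Q) (inf_le_right.trans hQ) inf_le_left
  refine ⟨F ⊔ G, hF.sup hG, sup_le h1 (h3.trans inf_le_right), ?_⟩
  refine h2.trans (sup_le (le_sup_left.trans le_sup_left) (h4.trans ?_))
  refine sup_le (le_sup_right.trans le_sup_left) (le_trans ?_ le_sup_right)
  refine inf_le_left.trans ?_
  have : J * (I * N) ≤ (I ⊓ J) * N := by
    rw [← mul_assoc, mul_comm J I]
    exact Ideal.mul_mono_left Ideal.mul_le_inf
  exact fun x hx => this hx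

lemma fgK [IsNoetherianRing B] {I J : Ideal B} (hI : HH A I) (hJ : HH A J)
    (hK : rs A (I ⊓ J) ≤ 1) : (rs A (I ⊓ J)).FG := by
  obtain ⟨F, hF, h1, h2⟩ := step hI hJ (I ⊓ J) (rs A (I ⊓ J)) hK le_rfl
  obtain ⟨t, ht⟩ := (isNoetherianRing_iff_ideal_fg B).1 inferInstance (I ⊓ J)
  have ht' : Ideal.span (t : Set B) = I ⊓ J := ht
  have h3 : rs A ((I ⊓ J) * (I ⊓ J)) ≤ Submodule.span A (t : Set B) := by
    have := mul_span_le (A := A) (I ⊓ J) (t : Set B)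
    rw [ht'] at this
    exact this.trans ((mul_le_mul' hK le_rfl).trans (one_mul _).le)
  have h4 : Submodule.span A (t : Set B) ≤ rs A (I ⊓ J) := by
    rw [Submodule.span_le]
    intro x hx
    have : x ∈ Ideal.span (t : Set B) := Ideal.subset_span hx
    rw [ht'] at this
    exact this
  have : rs A (I ⊓ J) = F ⊔ Submodule.span A (t : Set B) :=
    le_antisymm (h2.trans (sup_le_sup le_rfl h3)) (sup_le h1 h4)
  rw [this]
  exact hF.sup ⟨t, rfl⟩

lemma fgQ [IsNoetherianRing B] {I J : Ideal B} (hI : HH A I) (hJ : HH A J)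
    (hK : rs A (I ⊓ J) ≤ 1) (Q : Submodule A B) (hQ : Q ≤ 1) : Q.FG := by
  obtain ⟨t, htQ, ht⟩ := (Submodule.fg_span_iff_fg_span_finset_subset (R := B) (Q : Set B)).1
    ((isNoetherianRing_iff_ideal_fg B).1 inferInstance (Ideal.span (Q : Set B)))
  have ht' : Ideal.span (Q : Set B) = Ideal.span (t : Set B) := ht
  obtain ⟨F, hF, h1, h2⟩ := step hI hJ (Ideal.span (Q : Set B)) Q hQ
    (fun x hx => Ideal.subset_span hx)
  have h3 := mul_span_le (A := A) (I ⊓ J) (t : Set B)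
  rw [← ht'] at h3
  have h4 : rs A (I ⊓ J) * Submodule.span A (t : Set B) ≤ Q :=
    (mul_le_mul' hK (Submodule.span_le.2 htQ)).trans (one_mul _).le
  have : Q = F ⊔ rs A (I ⊓ J) * Submodule.span A (t : Set B) :=
    le_antisymm (h2.trans (sup_le_sup le_rfl h3)) (sup_le h1 h4)
  rw [this]
  exact hF.sup ((fgK hI hJ hK).mul ⟨t, rfl⟩)

lemma main [IsNoetherianRing B] {I J : Ideal B} (hI : HH A I) (hJ : HH A J)
    (hK : rs A (I ⊓ J) ≤ 1) (hinj : Function.Injective (algebraMap A B)) :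
    IsNoetherianRing A := by
  rw [isNoetherianRing_iff_ideal_fg]
  intro a
  refine Submodule.fg_of_fg_map_injective (Algebra.linearMap A B) hinj ?_
  refine fgQ hI hJ hK _ ?_
  rw [Submodule.one_eq_range]
  exact LinearMap.map_le_range

lemma hh_of {B : Type*} [CommRing B] (A : Subring B) (I : Ideal B) (T : Subring B)
    (hT : A.addIdeal I = T) (h : IsNoetherianRing T) : HH A I := by
  subst hT
  intro Q hQ
  have hQ' : ∀ x ∈ Q, x ∈ A.addIdeal I := by
    intro x hx
    obtain ⟨y, hy, z, hz, rfl⟩ := Submodule.mem_sup.1 (hQ hx)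
    obtain ⟨a, rfl⟩ := Submodule.mem_one.1 hy
    exact ⟨a, a.2, z, hz, rfl⟩
  let s : Set (A.addIdeal I) := {x | (x : B) ∈ Q}
  obtain ⟨t, hts, ht⟩ := (Submodule.fg_span_iff_fg_span_finset_subset (R := A.addIdeal I) s).1
    ((isNoetherianRing_iff_ideal_fg _).1 h (Ideal.span s))
  classical
  have hF : Submodule.span A ((fun x : A.addIdeal I => (x : B)) '' (t : Set (A.addIdeal I))) ≤ Q := by
    rw [Submodule.span_le]
    rintro _ ⟨x, hx, rfl⟩
    exact hts hx
  refine ⟨_, Submodule.fg_span (t.finite_toSet.image _), hF, ?_⟩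
  set F := Submodule.span A ((fun x : A.addIdeal I => (x : B)) '' (t : Set (A.addIdeal I))) with hFd
  have hIF : rs A I * (F ⊔ rs A I * Q) ≤ F ⊔ rs A I * Q := by
    rw [Submodule.mul_sup, ← mul_assoc]
    refine le_trans (sup_le (mul_le_mul' le_rfl hF) (mul_le_mul' ?_ le_rfl)) le_sup_right
    exact (rs_mul_rs I I).trans (fun x hx => Ideal.mul_le_left hx)
  intro x hx
  have hxs : (⟨x, hQ' x hx⟩ : A.addIdeal I) ∈ Submodule.span (A.addIdeal I) s :=
    Submodule.subset_span hx
  rw [ht] at hxs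
  have key : ∀ y ∈ Submodule.span (A.addIdeal I) (t : Set (A.addIdeal I)),
      (y : B) ∈ F ⊔ rs A I * Q := by
    intro y hy
    induction hy using Submodule.span_induction with
    | mem y hy => exact Submodule.mem_sup_left (Submodule.subset_span ⟨y, hy, rfl⟩)
    | zero => exact zero_mem _
    | add y z _ _ h1 h2 => exact add_mem h1 h2
    | smul b y _ hy =>
      obtain ⟨b, a, ha, i, hi, rfl⟩ := b
      change (a + i) * (y : B) ∈ _
      rw [add_mul]
      exact add_mem (Submodule.smul_mem _ (⟨a, ha⟩ : A) hy) (hIF (Submodule.mul_mem_mul hi hy))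
  exact key _ hxs

lemma sub_main {B : Type*} [CommRing B] [IsNoetherianRing B] (S A : Subring B) (I J : Ideal B)
    (hI : IsNoetherianRing (S.addIdeal I)) (hJ : IsNoetherianRing (S.addIdeal J))
    (hS : S ≤ A) (hAI : A ≤ S.addIdeal I) (hAJ : A ≤ S.addIdeal J)
    (hK : ∀ x ∈ I ⊓ J, x ∈ A) : IsNoetherianRing A := by
  have aux : ∀ L : Ideal B, A ≤ S.addIdeal L → A.addIdeal L = S.addIdeal L := by
    intro L hL
    apply le_antisymm
    · rintro _ ⟨a, ha, i, hi, rfl⟩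
      obtain ⟨s, hs, j, hj, rfl⟩ := hL ha
      exact ⟨s, hs, j + i, add_mem hj hi, by ring⟩
    · rintro _ ⟨s, hs, i, hi, rfl⟩
      exact ⟨s, hS hs, i, hi, rfl⟩
  refine main (hh_of A I _ (aux I hAI) hI) (hh_of A J _ (aux J hAJ) hJ) ?_ Subtype.val_injective
  intro x hx
  exact Submodule.mem_one.2 ⟨⟨x, hK x hx⟩, rfl⟩

end PO



/-- Let `B` be Noetherian, `S ⊆ B` a subring and `I, J` ideals of `B`.
If the subrings `S+I` and `S+J` are Noetherian, then so are `S+(I∩J)` and `(S+I)∩(S+J)`. -/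
theorem pushouts_stmt13 (B : Type*) [CommRing B] [IsNoetherianRing B]
    (S : Subring B) (I J : Ideal B)
    (hI : IsNoetherianRing (S.addIdeal I)) (hJ : IsNoetherianRing (S.addIdeal J)) :
    IsNoetherianRing (S.addIdeal (I ⊓ J)) ∧
    IsNoetherianRing (S.addIdeal I ⊓ S.addIdeal J : Subring B) := by
  have h0 : ∀ L : Ideal B, S ≤ S.addIdeal L := fun L x hx => ⟨x, hx, 0, L.zero_mem, by ring⟩
  constructor
  · refine PO.sub_main S _ I J hI hJ (h0 _) ?_ ?_ ?_
    · rintro _ ⟨s, hs, i, hi, rfl⟩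
      exact ⟨s, hs, i, hi.1, rfl⟩
    · rintro _ ⟨s, hs, i, hi, rfl⟩
      exact ⟨s, hs, i, hi.2, rfl⟩
    · intro x hx
      exact ⟨0, S.zero_mem, x, hx, by ring⟩
  · refine PO.sub_main S _ I J hI hJ (le_inf (h0 _) (h0 _)) inf_le_left inf_le_right ?_
    intro x hx
    exact ⟨⟨0, S.zero_mem, x, hx.1, by ring⟩, ⟨0, S.zero_mem, x, hx.2, by ring⟩⟩
end

section
/- Let K be a field, let B be a commutative K-algebra that is an integral domain, and let S_1, S_2 ⊆ B be finitely generated K-subalgebras. Then S_1 ∩ S_2 is a finitely generated K-algebra if and only if there exist finite generating sets g_1,...,g_m of S_1 and h_1,...,h_n of S_2 (as K-algebras) such that S_1 ∩ S_2 is spanned as a K-vector space by M, where M denotes the intersection of the multiplicative submonoid of B generated by {g_1,...,g_m} with the multiplicative submonoid of B generated by {h_1,...,h_n}. -/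
open nonZeroDivisors

theorem aux_add {N : Type*} [AddCommMonoid N] [IsCancelAdd N] {P Q : AddSubmonoid N}
    (hP : P.FG) (hQ : Q.FG) : (P ⊓ Q).FG := by
  obtain ⟨m, f, rfl⟩ := AddSubmonoid.fg_iff_exists_fin_addMonoidHom.1 hP
  obtain ⟨n, g, rfl⟩ := AddSubmonoid.fg_iff_exists_fin_addMonoidHom.1 hQ
  have h := AddSubmonoid.fg_eqLocusM
    (f.comp (AddMonoidHom.fst (Fin m → ℕ) (Fin n → ℕ)))
    (g.comp (AddMonoidHom.snd (Fin m → ℕ) (Fin n → ℕ)))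
  have h2 := h.map (f.comp (AddMonoidHom.fst (Fin m → ℕ) (Fin n → ℕ)))
  convert h2 using 1
  ext x
  simp only [AddSubmonoid.mem_inf, AddMonoidHom.mem_mrange, AddSubmonoid.mem_map,
    AddMonoidHom.mem_eqLocusM, AddMonoidHom.comp_apply, AddMonoidHom.coe_fst, AddMonoidHom.coe_snd,
    Prod.exists]
  constructor
  · rintro ⟨⟨a, rfl⟩, b, hb⟩
    exact ⟨a, b, hb.symm, rfl⟩
  · rintro ⟨a, b, h, rfl⟩
    exact ⟨⟨a, rfl⟩, b, h.symm⟩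

theorem aux_mul {N : Type*} [CommMonoid N] [IsCancelMul N] {P Q : Submonoid N}
    (hP : P.FG) (hQ : Q.FG) : (P ⊓ Q).FG := by
  rw [Submonoid.fg_iff_add_fg] at *
  exact aux_add hP hQ

theorem aux_comap {B : Type*} [CommRing B] [IsDomain B] (g : Finset B) :
    ((Submonoid.closure (g : Set B)).comap (B⁰).subtype).FG := by
  rw [Submonoid.fg_iff]
  refine ⟨(B⁰).subtype ⁻¹' g, le_antisymm ?_ ?_,
    g.finite_toSet.preimage Subtype.val_injective.injOn⟩
  · rw [Submonoid.closure_le]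
    intro x hx
    exact Submonoid.subset_closure hx
  · rintro ⟨x, hx⟩ h
    replace h : x ∈ Submonoid.closure (g : Set B) := h
    induction h using Submonoid.closure_induction with
    | mem x h => exact Submonoid.subset_closure h
    | one => exact Submonoid.one_mem _
    | mul x y _ _ ihx ihy =>
      obtain ⟨h1, h2⟩ := mul_mem_nonZeroDivisors.1 hx
      exact Submonoid.mul_mem _ (ihx h1) (ihy h2)


/-- Let `K` be a field, `B` a commutative `K`-algebra which is a domain, and
`S₁, S₂ ⊆ B` finitely generated `K`-subalgebras. Then `S₁ ∩ S₂` is a finitely generated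
`K`-algebra iff there are finite generating sets `g` of `S₁` and `h` of `S₂` such that the
intersection `M` of the multiplicative submonoids generated by `g` and by `h` spans
`S₁ ∩ S₂` as a `K`-vector space. -/
theorem pushouts_stmt14 (K : Type*) [Field K] (B : Type*) [CommRing B] [IsDomain B]
    [Algebra K B] (S₁ S₂ : Subalgebra K B) (h₁ : S₁.FG) (h₂ : S₂.FG) :
    (S₁ ⊓ S₂).FG ↔
      ∃ (g h : Finset B),
        Algebra.adjoin K (g : Set B) = S₁ ∧
        Algebra.adjoin K (h : Set B) = S₂ ∧
        Submodule.span K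
            ((Submonoid.closure (g : Set B) ⊓ Submonoid.closure (h : Set B) : Submonoid B) : Set B)
          = Subalgebra.toSubmodule (S₁ ⊓ S₂) := by
  classical
  constructor
  · rintro ⟨t, ht⟩
    obtain ⟨g, hg⟩ := h₁
    obtain ⟨h, hh⟩ := h₂
    have e1 : Algebra.adjoin K ((g ∪ t : Finset B) : Set B) = S₁ := by
      rw [Finset.coe_union, Algebra.adjoin_union, hg, ht]; exact sup_eq_left.2 inf_le_left
    have e2 : Algebra.adjoin K ((h ∪ t : Finset B) : Set B) = S₂ := by
      rw [Finset.coe_union, Algebra.adjoin_union, hh, ht]; exact sup_eq_left.2 inf_le_right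
    refine ⟨g ∪ t, h ∪ t, e1, e2, le_antisymm ?_ ?_⟩
    · rw [Submodule.span_le]
      rintro x ⟨hx1, hx2⟩
      refine ⟨?_, ?_⟩
      · rw [← e1]
        exact (Submonoid.closure_le (S := (Algebra.adjoin K _).toSubmonoid)).2
          Algebra.subset_adjoin hx1
      · rw [← e2]
        exact (Submonoid.closure_le (S := (Algebra.adjoin K _).toSubmonoid)).2
          Algebra.subset_adjoin hx2
    · rw [← ht, Algebra.adjoin_eq_span]
      refine Submodule.span_mono (le_inf ?_ ?_) <;>
        exact Submonoid.closure_mono (by simp)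
  · rintro ⟨g, h, -, -, hs⟩
    have hc : IsCancelMul (B⁰) := by
      have : IsLeftCancelMul (B⁰) := ⟨fun a b c hbc => Subtype.ext
        (mul_left_cancel₀ (nonZeroDivisors.ne_zero a.2) (congrArg Subtype.val hbc))⟩
      exact CommMagma.IsLeftCancelMul.toIsCancelMul _
    obtain ⟨T, hT⟩ := (aux_mul (aux_comap g) (aux_comap h)).map (B⁰).subtype
    refine ⟨T, ?_⟩
    apply Subalgebra.toSubmodule_injective
    rw [← hs, Algebra.adjoin_eq_span, hT]
    apply le_antisymm
    · refine Submodule.span_mono ?_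
      rintro _ ⟨x, hx, rfl⟩
      exact hx
    · rw [Submodule.span_le]
      intro x hx
      by_cases h0 : x = 0
      · rw [h0]; exact Submodule.zero_mem _
      · exact Submodule.subset_span ⟨⟨x, mem_nonZeroDivisors_of_ne_zero h0⟩, hx, rfl⟩
end

section
/- Let A, B, C be commutative Noetherian rings and let φ: B → A and ψ: C → A be ring homomorphisms. Set B' = φ⁻¹(Im φ ∩ Im ψ), a subring of B, and C' = ψ⁻¹(Im φ ∩ Im ψ), a subring of C, and suppose that B' contains an ideal of B which contains a non-zero-divisor of B, and that C' contains an ideal of C which contains a non-zero-divisor of C. Then the pullback P = {(b,c) ∈ B × C : φ(b) = ψ(c)} is a Noetherian ring if and only if B is a finitely generated B'-module and C is a finitely generated C'-module. -/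
theorem en_step (R S : Type*) [CommRing R] [CommRing S] [Algebra R S] [Module.Finite R S]
    (h : ∀ J : Ideal S, J ≠ ⊥ → IsNoetherian R (S ⧸ J)) : IsNoetherian R S := by
  have hL : ∀ a : R, (LinearMap.range (LinearMap.lsmul R S a)).FG := fun a => by
    rw [LinearMap.range_eq_map]
    exact Submodule.FG.map _ Module.Finite.fg_top
  obtain ⟨N0, hN0⟩ := zorn_le₀ {N : Submodule R S |
      ∀ a : R, LinearMap.range (LinearMap.lsmul R S a) ≤ N → algebraMap R S a = 0} (by
    intro c hc hchain
    rcases c.eq_empty_or_nonempty with rfl | hne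
    · refine ⟨⊥, ?_, by simp⟩
      intro a ha
      have : a • (1 : S) ∈ (⊥ : Submodule R S) := ha ⟨1, rfl⟩
      rw [Algebra.algebraMap_eq_smul_one]
      simpa using this
    · refine ⟨sSup c, ?_, fun z hz => le_sSup hz⟩
      intro a ha
      obtain ⟨N, hN, hle⟩ := (CompleteLattice.isCompactElement_iff_le_of_directed_sSup_le _ _).1
        ((Submodule.fg_iff_compact _).1 (hL a)) c hne hchain.directedOn ha
      exact hc hN a hle)
  have hfg : ∀ N : Submodule R S, N0 < N → N.FG := by
    intro N hN
    have : ¬ (∀ a : R, LinearMap.range (LinearMap.lsmul R S a) ≤ N → algebraMap R S a = 0) := by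
      intro hh
      exact hN.not_ge (hN0.2 hh hN.le)
    push Not at this
    obtain ⟨a, ha, ha0⟩ := this
    have hJ := h (Ideal.span {algebraMap R S a}) (by simpa using ha0)
    refine Submodule.fg_of_fg_map_of_fg_inf_ker
      (Ideal.Quotient.mkₐ R (Ideal.span {algebraMap R S a})).toLinearMap
      (IsNoetherian.noetherian _) ?_
    refine Eq.mpr (congrArg Submodule.FG ?_) (hL a)
    refine Submodule.ext fun x => ?_
    have key : x ∈ LinearMap.ker
        (Ideal.Quotient.mkₐ R (Ideal.span {algebraMap R S a})).toLinearMap ↔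
        x ∈ LinearMap.range (LinearMap.lsmul R S a) := by
      simp only [LinearMap.mem_ker, AlgHom.toLinearMap_apply, Ideal.Quotient.mkₐ_eq_mk,
        Ideal.Quotient.eq_zero_iff_mem, Ideal.mem_span_singleton', LinearMap.mem_range,
        LinearMap.lsmul_apply, Algebra.smul_def, mul_comm]
    rw [Submodule.mem_inf, key]
    exact ⟨fun h => h.2, fun h => ⟨ha h, h⟩⟩
  have hnoeth : IsNoetherian R (S ⧸ N0) := by
    refine ⟨fun N' => ?_⟩
    have e : (N'.comap N0.mkQ).map N0.mkQ = N' :=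
      Submodule.map_comap_eq_of_surjective N0.mkQ_surjective _
    rcases (Submodule.le_comap_mkQ N0 N').eq_or_lt with h1 | h1
    · have : N' = ⊥ := by
        rw [← e, ← h1]; exact N0.mkQ_map_self
      rw [this]; exact Submodule.fg_bot
    · rw [← e]; exact (hfg _ h1).map _
  obtain ⟨s, hs⟩ := (Module.Finite.fg_top : (⊤ : Submodule R S).FG)
  let f : R →ₗ[R] (s → S ⧸ N0) :=
    LinearMap.pi fun i => N0.mkQ.comp (LinearMap.toSpanSingleton R S (i : S))
  have hker : ∀ a ∈ LinearMap.ker f, algebraMap R S a = 0 := by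
    intro a ha
    apply hN0.1 a
    rw [LinearMap.range_eq_map, ← hs, Submodule.map_span_le]
    intro m hm
    have := congrFun (LinearMap.mem_ker.1 ha) ⟨m, hm⟩
    simpa [f, -Submodule.Quotient.mk_smul, Submodule.Quotient.mk_eq_zero,
      ← Submodule.Quotient.mk_smul] using this
  have hR : IsNoetherian R (R ⧸ LinearMap.ker f) :=
    isNoetherian_of_injective ((LinearMap.ker f).liftQ f le_rfl)
      (LinearMap.ker_eq_bot.1 (Submodule.ker_liftQ_eq_bot _ _ _ le_rfl))
  rw [← isNoetherian_top_iff, ← hs]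
  have : Submodule.span R (s : Set S) = ⨆ i : s, LinearMap.range
      ((LinearMap.ker f).liftQ (LinearMap.toSpanSingleton R S (i : S)) (fun a ha => by
        simp [Algebra.smul_def, hker a ha])) := by
    simp only [Submodule.range_liftQ, LinearMap.range_toSpanSingleton]
    rw [Submodule.span_eq_iSup_of_singleton_spans, iSup_subtype']
    rfl
  rw [this]
  infer_instance

theorem en_main (R S : Type*) [CommRing R] [CommRing S] [Algebra R S] [Module.Finite R S]
    [IsNoetherianRing S] : IsNoetherian R S := by
  have main : ∀ J : Ideal S, IsNoetherian R (S ⧸ J) := by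
    intro J
    induction J using IsNoetherian.induction with
    | hgt J ih =>
    apply en_step
    intro L hL
    have hlt : J < L.comap (Ideal.Quotient.mk J) := by
      refine lt_of_le_of_ne ?_ ?_
      · intro x hx
        simp [Ideal.mem_comap, Ideal.Quotient.eq_zero_iff_mem.2 hx]
      · intro e
        apply hL
        rw [← Ideal.map_comap_of_surjective _ Ideal.Quotient.mk_surjective L, ← e]
        exact Ideal.map_quotient_self J
    have := ih _ hlt
    refine isNoetherian_of_surjective (Ideal.quotientMapₐ (R₁ := R) (I := L.comap (Ideal.Quotient.mk J)) L
      (Ideal.Quotient.mkₐ R J) le_rfl).toLinearMap (LinearMap.range_eq_top.2 ?_)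
    intro x
    obtain ⟨y, rfl⟩ := Ideal.Quotient.mk_surjective x
    obtain ⟨z, rfl⟩ := Ideal.Quotient.mk_surjective y
    exact ⟨Ideal.Quotient.mk _ z, rfl⟩
  have := main ⊥
  exact isNoetherian_of_injective (Ideal.Quotient.mkₐ R (⊥ : Ideal S)).toLinearMap (by
    intro x y hxy
    have : Ideal.Quotient.mk (⊥ : Ideal S) x = Ideal.Quotient.mk ⊥ y := hxy
    rw [Ideal.Quotient.eq] at this
    exact sub_eq_zero.1 (by simpa using this))

theorem en_subring {S : Type*} [CommRing S] [IsNoetherianRing S] (R : Subring S)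
    (h : Module.Finite R S) : IsNoetherianRing R := by
  have := en_main R S
  rw [isNoetherianRing_iff]
  exact isNoetherian_of_injective (Algebra.linearMap R S) Subtype.val_injective

theorem fin_of_noeth {S : Type*} [CommRing S] (R : Subring S) [IsNoetherianRing R]
    (h : ∃ I : Ideal S, (I : Set S) ⊆ R ∧ ∃ r ∈ I, r ∈ nonZeroDivisors S) :
    Module.Finite R S := by
  obtain ⟨I, hI, r, hr, hr0⟩ := h
  let f : S →ₗ[R] R :=
    { toFun := fun x => ⟨x * r, hI (I.mul_mem_left x hr)⟩
      map_add' := fun x y => Subtype.ext (add_mul x y r)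
      map_smul' := fun a x => Subtype.ext (mul_assoc (a : S) x r) }
  have hf : Function.Injective f := fun x y hxy =>
    (mul_cancel_right_mem_nonZeroDivisors hr0).1 (congrArg Subtype.val hxy)
  have := isNoetherian_of_injective f hf
  infer_instance

theorem noeth_over {P X : Type*} [CommRing P] [CommRing X] [Algebra P X]
    [IsNoetherianRing X] (hf : Function.Surjective (algebraMap P X)) : IsNoetherian P X := by
  refine ⟨fun N => ?_⟩
  let I : Ideal X :=
    { N with
      smul_mem' := fun c x hx => by
        obtain ⟨p, rfl⟩ := hf c
        have := N.smul_mem p hx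
        rwa [Algebra.smul_def] at this }
  have hI : I.restrictScalars P = N := rfl
  rw [← hI]
  exact Submodule.FG.restrictScalars_of_surjective (IsNoetherian.noetherian I) hf

theorem noeth_of_two {P X Y : Type*} [CommRing P] [CommRing X] [CommRing Y]
    [IsNoetherianRing X] [IsNoetherianRing Y] (f : P →+* X) (g : P →+* Y)
    (hf : Function.Surjective f) (hg : Function.Surjective g)
    (h : ∀ p, f p = 0 → g p = 0 → p = 0) : IsNoetherianRing P := by
  let _ := f.toAlgebra
  let _ := g.toAlgebra
  have hX : IsNoetherian P X := noeth_over hf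
  have hY : IsNoetherian P Y := noeth_over hg
  rw [isNoetherianRing_iff]
  refine isNoetherian_of_injective
    ((Algebra.linearMap P X).prod (Algebra.linearMap P Y)) ?_
  rw [injective_iff_map_eq_zero]
  intro p hp
  exact h p (congrArg Prod.fst hp) (congrArg Prod.snd hp)


/-- Let `A, B, C` be commutative Noetherian rings, `φ : B → A`, `ψ : C → A`
ring homomorphisms, `B' = φ⁻¹(Im φ ∩ Im ψ)` and `C' = ψ⁻¹(Im φ ∩ Im ψ)`. Suppose `B'`
contains an ideal of `B` containing a non-zero-divisor of `B`, and likewise for `C'` in `C`.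
Then the pullback `P = {(b,c) : φ b = ψ c}` is Noetherian iff `B` is a finitely generated
`B'`-module and `C` is a finitely generated `C'`-module. -/
theorem pushouts_stmt16 (A B C : Type*) [CommRing A] [CommRing B] [CommRing C]
    [IsNoetherianRing A] [IsNoetherianRing B] [IsNoetherianRing C]
    (φ : B →+* A) (ψ : C →+* A)
    (hB' : ∃ I : Ideal B,
      (I : Set B) ⊆ ((φ.range ⊓ ψ.range).comap φ : Subring B) ∧
        ∃ r ∈ I, r ∈ nonZeroDivisors B)
    (hC' : ∃ J : Ideal C,
      (J : Set C) ⊆ ((φ.range ⊓ ψ.range).comap ψ : Subring C) ∧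
        ∃ r ∈ J, r ∈ nonZeroDivisors C) :
    IsNoetherianRing
        (RingHom.eqLocus (φ.comp (RingHom.fst B C)) (ψ.comp (RingHom.snd B C))) ↔
      (Module.Finite ((φ.range ⊓ ψ.range).comap φ) B ∧
        Module.Finite ((φ.range ⊓ ψ.range).comap ψ) C) := by
  let P := RingHom.eqLocus (φ.comp (RingHom.fst B C)) (ψ.comp (RingHom.snd B C))
  let f : P →+* ((φ.range ⊓ ψ.range).comap φ : Subring B) :=
    ((RingHom.fst B C).comp P.subtype).codRestrict _ (fun p =>
      ⟨⟨p.1.1, rfl⟩, ⟨p.1.2, (show φ p.1.1 = ψ p.1.2 from p.2).symm⟩⟩)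
  let g : P →+* ((φ.range ⊓ ψ.range).comap ψ : Subring C) :=
    ((RingHom.snd B C).comp P.subtype).codRestrict _ (fun p =>
      ⟨⟨p.1.1, (show φ p.1.1 = ψ p.1.2 from p.2)⟩, ⟨p.1.2, rfl⟩⟩)
  have hf : Function.Surjective f := by
    rintro ⟨b, -, c, hc⟩
    exact ⟨⟨(b, c), hc.symm⟩, rfl⟩
  have hg : Function.Surjective g := by
    rintro ⟨c, ⟨b, hb⟩, -⟩
    exact ⟨⟨(b, c), hb⟩, rfl⟩
  constructor
  · intro hP
    have h1 := isNoetherianRing_of_surjective _ _ f hf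
    have h2 := isNoetherianRing_of_surjective _ _ g hg
    exact ⟨fin_of_noeth _ hB', fin_of_noeth _ hC'⟩
  · rintro ⟨h1, h2⟩
    have h1' := en_subring _ h1
    have h2' := en_subring _ h2
    refine noeth_of_two f g hf hg ?_
    intro p hp hq
    exact Subtype.ext (Prod.ext (congrArg Subtype.val hp) (congrArg Subtype.val hq))
end

section
/- Let K be a field. The K-subalgebra K + (y) of the polynomial ring K[x,y], whose underlying set is {c + f : c ∈ K, f ∈ (y)} where (y) is the ideal of K[x,y] generated by y, is not a finitely generated K-algebra. -/
/-- For an ideal `I` of a commutative `K`-algebra `B`, the `K`-subalgebra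
`K + I = {c·1 + i : c ∈ K, i ∈ I}` of `B`. -/
def kPlus (K : Type*) {B : Type*} [CommSemiring K] [CommRing B] [Algebra K B]
    (I : Ideal B) : Subalgebra K B where
  carrier := {x : B | ∃ c : K, ∃ i ∈ I, x = algebraMap K B c + i}
  zero_mem' := ⟨0, 0, I.zero_mem, by simp⟩
  one_mem' := ⟨1, 0, I.zero_mem, by simp⟩
  add_mem' := by
    rintro a b ⟨c, i, hi, rfl⟩ ⟨d, j, hj, rfl⟩
    exact ⟨c + d, i + j, I.add_mem hi hj, by rw [map_add]; ring⟩
  mul_mem' := by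
    rintro a b ⟨c, i, hi, rfl⟩ ⟨d, j, hj, rfl⟩
    exact ⟨c * d,
      algebraMap K B c * j + i * algebraMap K B d + i * j,
      I.add_mem (I.add_mem (I.mul_mem_left _ hj) (I.mul_mem_right _ hi)) (I.mul_mem_left _ hj),
      by rw [map_mul]; ring⟩
  algebraMap_mem' := fun c => ⟨c, 0, I.zero_mem, by ring⟩

/-- Auxiliary subalgebra: bounded `x`-degree in `y`-degree one. -/
def auxSub (K : Type*) [Field K] (N : ℕ) : Subalgebra K (MvPolynomial (Fin 2) K) where
  carrier := {p | ∀ m : Fin 2 →₀ ℕ, (m 1 = 0 ∧ 1 ≤ m 0) ∨ (m 1 = 1 ∧ N < m 0) →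
    MvPolynomial.coeff m p = 0}
  add_mem' := by
    intro a b ha hb m hm
    rw [MvPolynomial.coeff_add, ha m hm, hb m hm, add_zero]
  mul_mem' := by
    intro a b ha hb m hm
    rw [MvPolynomial.coeff_mul]
    refine Finset.sum_eq_zero ?_
    rintro ⟨u, v⟩ huv
    rw [Finset.HasAntidiagonal.mem_antidiagonal] at huv
    have h0 : u 0 + v 0 = m 0 := by rw [← huv]; rfl
    have h1 : u 1 + v 1 = m 1 := by rw [← huv]; rfl
    have : ((u 1 = 0 ∧ 1 ≤ u 0) ∨ (u 1 = 1 ∧ N < u 0)) ∨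
        ((v 1 = 0 ∧ 1 ≤ v 0) ∨ (v 1 = 1 ∧ N < v 0)) := by
      omega
    rcases this with h | h
    · simp [ha u h]
    · simp [hb v h]
  algebraMap_mem' := by
    intro c m hm
    rw [MvPolynomial.algebraMap_eq, MvPolynomial.coeff_C, if_neg]
    rintro rfl
    simp at hm

/-- For a field `K`, the `K`-subalgebra `K + (y)` of `K[x,y]`
(here `K[x,y] = MvPolynomial (Fin 2) K` with `x = X 0`, `y = X 1`) is not a finitely
generated `K`-algebra. -/
theorem pushouts_stmt17 (K : Type*) [Field K] :
    ¬ (kPlus K (Ideal.span {(MvPolynomial.X 1 : MvPolynomial (Fin 2) K)})).FG := by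
  rintro ⟨s, hs⟩
  set N := s.sup MvPolynomial.totalDegree with hN
  have hle : kPlus K (Ideal.span {(MvPolynomial.X 1 : MvPolynomial (Fin 2) K)}) ≤ auxSub K N := by
    rw [← hs, Algebra.adjoin_le_iff]
    intro p hp m hm
    have hp' : p ∈ kPlus K (Ideal.span {(MvPolynomial.X 1 : MvPolynomial (Fin 2) K)}) := by
      rw [← hs]; exact Algebra.subset_adjoin hp
    rcases hm with hm | hm
    · obtain ⟨c, i, hi, rfl⟩ := hp'
      obtain ⟨q, rfl⟩ := Ideal.mem_span_singleton'.1 hi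
      rw [MvPolynomial.coeff_add, MvPolynomial.algebraMap_eq, MvPolynomial.coeff_C, if_neg,
        MvPolynomial.coeff_mul_X', if_neg, add_zero]
      · simp [hm.1]
      · rintro rfl
        simp at hm
    · by_contra hne
      have h1 := MvPolynomial.le_totalDegree (MvPolynomial.mem_support_iff.2 hne)
      have h2 : p.totalDegree ≤ N := Finset.le_sup (f := MvPolynomial.totalDegree) hp
      rw [Finsupp.sum_fintype _ _ (fun _ => rfl), Fin.sum_univ_two] at h1
      omega
  have hmem : (MvPolynomial.monomial (Finsupp.single 0 (N + 1)) 1 * MvPolynomial.X 1 :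
      MvPolynomial (Fin 2) K) ∈ auxSub K N :=
    hle ⟨0, _, Ideal.mem_span_singleton'.2 ⟨_, rfl⟩, by rw [map_zero, zero_add]⟩
  have := hmem (Finsupp.single 0 (N + 1) + Finsupp.single 1 1) (Or.inr (by simp))
  rw [MvPolynomial.coeff_mul_X, MvPolynomial.coeff_monomial, if_pos rfl] at this
  exact one_ne_zero this
end

section
/- Let K be a field, let L be a finitely generated commutative K-algebra, and let 𝔪_1,...,𝔪_n be maximal ideals of L with I = 𝔪_1 ∩ ... ∩ 𝔪_n. Then the K-subalgebra K + I of L, whose underlying set is {c·1 + f : c ∈ K, f ∈ I}, is a finitely generated K-algebra. -/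
/-- Let `K` be a field, `L` a finitely generated commutative `K`-algebra and
`𝔪_1, …, 𝔪_n` maximal ideals of `L` with `I = 𝔪_1 ∩ … ∩ 𝔪_n`. Then the `K`-subalgebra
`K + I` of `L` is a finitely generated `K`-algebra. -/
theorem pushouts_stmt18 (K : Type*) [Field K] (L : Type*) [CommRing L] [Algebra K L]
    [Algebra.FiniteType K L] (n : ℕ) (𝔪 : Fin n → Ideal L)
    (hmax : ∀ i, (𝔪 i).IsMaximal) :
    (kPlus K (⨅ i, 𝔪 i)).FG := by
  classical
  set I : Ideal L := ⨅ i, 𝔪 i with hI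
  have hfin : ∀ i, Module.Finite K (L ⧸ 𝔪 i) := fun i => by
    have := hmax i
    letI := Ideal.Quotient.field (𝔪 i)
    exact finite_of_finite_type_of_isJacobsonRing K (L ⧸ 𝔪 i)
  let φ : L →ₗ[K] (∀ i, L ⧸ 𝔪 i) := LinearMap.pi fun i => (Ideal.Quotient.mkₐ K (𝔪 i)).toLinearMap
  have hφ : ∀ x, φ x = 0 → x ∈ I := fun x hx => by
    rw [hI, Ideal.mem_iInf]
    intro i
    exact Ideal.Quotient.eq_zero_iff_mem.mp (congrFun hx i)
  obtain ⟨g, hg⟩ := φ.rangeRestrict.exists_rightInverse_of_surjective φ.range_rangeRestrict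
  have hgφ : ∀ x, φ (g (φ.rangeRestrict x)) = φ x := fun x =>
    congrArg Subtype.val (LinearMap.congr_fun hg (φ.rangeRestrict x))
  have hfg : (LinearMap.range g).FG := by
    rw [LinearMap.range_eq_map]
    exact Submodule.FG.map _ (Module.Finite.fg_top)
  obtain ⟨T, hT⟩ := hfg
  have hBC : (⊤ : Submodule (kPlus K I) L).FG := by
    refine ⟨insert 1 T, ?_⟩
    rw [eq_top_iff]
    intro x _
    have h1 : g (φ.rangeRestrict x) ∈
        Submodule.span (kPlus K I) ((insert 1 T : Finset L) : Set L) := by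
      have h : g (φ.rangeRestrict x) ∈ Submodule.span K (T : Set L) := by
        rw [hT]; exact ⟨_, rfl⟩
      have h2 := Submodule.span_le_restrictScalars K (kPlus K I) (T : Set L) h
      exact Submodule.span_mono (by simp) h2
    have h3 : x - g (φ.rangeRestrict x) ∈ I := hφ _ (by rw [map_sub, hgφ, sub_self])
    have h4 : x - g (φ.rangeRestrict x) ∈
        Submodule.span (kPlus K I) ((insert 1 T : Finset L) : Set L) := by
      have h5 : (1 : L) ∈ Submodule.span (kPlus K I) ((insert 1 T : Finset L) : Set L) :=
        Submodule.subset_span (by simp)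
      have h6 := Submodule.smul_mem _
        (⟨x - g (φ.rangeRestrict x), 0, _, h3, by simp⟩ : kPlus K I) h5
      rw [Subalgebra.smul_def, smul_eq_mul, mul_one] at h6
      exact h6
    have := Submodule.add_mem _ h4 h1
    rwa [sub_add_cancel] at this
  have := fg_of_fg_of_fg K (kPlus K I) L Algebra.FiniteType.out hBC Subtype.val_injective
  exact (Subalgebra.fg_top _).mp this
end

section
/- Let K be a field and let a_1,...,a_n ∈ K be pairwise distinct. Set φ_0(x) = (x - a_1)···(x - a_n) ∈ K[x] and φ_i(x) = x^i · φ_0(x) for 0 ≤ i ≤ n-1, and let I = (φ_0) be the ideal of K[x] generated by φ_0. Then the K-subalgebra K + I of K[x], whose underlying set is {c + f : c ∈ K, f ∈ I}, equals the K-subalgebra of K[x] generated by φ_0, φ_1, ..., φ_{n-1}. -/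
/-- Let `K` be a field and `a_1, …, a_n ∈ K` pairwise distinct, `n ≥ 1`.
With `φ₀ = (x-a_1)⋯(x-a_n)` and `φ_i = x^i·φ₀`, the `K`-subalgebra `K + (φ₀)` of `K[x]`
equals the `K`-subalgebra generated by `φ₀, φ₁, …, φ_{n-1}`. -/
theorem pushouts_stmt19 (K : Type*) [Field K] (n : ℕ) (hn : 0 < n)
    (a : Fin n → K) (ha : Function.Injective a) :
    kPlus K (Ideal.span {∏ i, (Polynomial.X - Polynomial.C (a i))}) =
      Algebra.adjoin K (Set.range fun i : Fin n =>
        (Polynomial.X : Polynomial K) ^ (i : ℕ) *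
          ∏ j, (Polynomial.X - Polynomial.C (a j))) := by
  set φ : Polynomial K := ∏ i, (Polynomial.X - Polynomial.C (a i)) with hφ
  have hm : φ.Monic := Polynomial.monic_prod_of_monic _ _ fun i _ => Polynomial.monic_X_sub_C _
  have hd : φ.natDegree = n := by
    rw [hφ, Polynomial.natDegree_prod_of_monic _ _ fun i _ => Polynomial.monic_X_sub_C _]
    simp
  set A := Algebra.adjoin K (Set.range fun i : Fin n => (Polynomial.X : Polynomial K) ^ (i : ℕ) * φ)
    with hA
  have hgen : ∀ i < n, (Polynomial.X : Polynomial K) ^ i * φ ∈ A := fun i hi =>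
    Algebra.subset_adjoin ⟨⟨i, hi⟩, rfl⟩
  have hlow : ∀ g : Polynomial K, g.natDegree < n → g * φ ∈ A := by
    intro g hg
    rw [g.as_sum_range' n hg, Finset.sum_mul]
    refine A.sum_mem fun i hi => ?_
    rw [← Polynomial.C_mul_X_pow_eq_monomial, mul_assoc, ← Polynomial.smul_eq_C_mul]
    exact A.smul_mem (hgen i (Finset.mem_range.1 hi)) _
  have hall : ∀ (m : ℕ) (g : Polynomial K), g.natDegree ≤ m → g * φ ∈ A := by
    intro m
    induction m using Nat.strong_induction_on with
    | _ m ih =>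
      intro g hg
      by_cases h : g.natDegree < n
      · exact hlow g h
      · have hq : (g /ₘ φ).natDegree = g.natDegree - n := by
          rw [Polynomial.natDegree_divByMonic g hm, hd]
        have h1 : (g /ₘ φ) * φ ∈ A := ih _ (by omega : g.natDegree - n < m) _ hq.le
        have h2 : (g %ₘ φ) * φ ∈ A := by
          apply hlow
          have := Polynomial.natDegree_modByMonic_lt g hm (by
            intro h1
            rw [h1] at hd
            simp at hd
            omega)
          omega
        have h3 : φ ∈ A := by simpa using hgen 0 hn
        have h4 : g * φ = (g %ₘ φ) * φ + φ * ((g /ₘ φ) * φ) := by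
          conv_lhs => rw [← Polynomial.modByMonic_add_div g φ]
          ring
        rw [h4]
        exact A.add_mem h2 (A.mul_mem h3 h1)
  apply le_antisymm
  · rintro x ⟨c, i, hi, rfl⟩
    obtain ⟨g, rfl⟩ := Ideal.mem_span_singleton'.1 hi
    exact A.add_mem (A.algebraMap_mem c) (hall _ g le_rfl)
  · refine Algebra.adjoin_le ?_
    rintro _ ⟨i, rfl⟩
    exact ⟨0, Polynomial.X ^ (i : ℕ) * φ, Ideal.mul_mem_left _ _ (Ideal.mem_span_singleton_self φ), by simp⟩
end
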